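/- arXiv:2602.17144 — 8 statements merged into one kernel-verified Lean document; each statement's English description precedes it below -/
import Mathlib

section
/- Let Φ : ℝ^{K+J} → ℝ^{K+J} be continuous and symmetric with respect to the last J inputs. Let S ⊆ Fin J be a fixed nonempty subset and let τ : ℝ^{K+J} → Fin J be any function such that for every θ ∈ ℝ^{K+J}, τ(θ) ∈ S and θ_{K+τ(θ)} = max_{j ∈ S} θ_{K+j}. Then for every y ∈ Fin K, the function θ ↦ Φ(θ)_y + Φ(θ)_{K+τ(θ)} is continuous on ℝ^{K+J}. (Taking S = {j : m_j = y} for a labelled example (y, m) with at least one correct expert, this says the PiCCE surrogate loss θ ↦ φ(θ, y) + φ(θ, K + argmax_{j : m_j = y} θ_{K+j}) is continuous in the score vector θ, for any tie-breaking choice of the argmax.) -/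
/-- A map that commutes with permutations of its last `J` inputs takes equal values at two of
these inputs whenever the corresponding scores are equal. -/
theorem symmetric_apply_eq_of_apply_eq {K J : ℕ} {Φ : (Fin (K + J) → ℝ) → (Fin (K + J) → ℝ)}
    (hΦsym : ∀ (θ θ' : Fin (K + J) → ℝ) (ρ : Equiv.Perm (Fin J)),
      (∀ j : Fin J, θ' (Fin.natAdd K (ρ j)) = θ (Fin.natAdd K j)) →
      (∀ y : Fin K, θ' (Fin.castAdd J y) = θ (Fin.castAdd J y)) →
      ∀ j : Fin J, Φ θ' (Fin.natAdd K (ρ j)) = Φ θ (Fin.natAdd K j))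
    {θ : Fin (K + J) → ℝ} {i j : Fin J} (h : θ (Fin.natAdd K i) = θ (Fin.natAdd K j)) :
    Φ θ (Fin.natAdd K i) = Φ θ (Fin.natAdd K j) := by
  have hswap := hΦsym θ θ (Equiv.swap i j) (fun k => ?_) (fun _ => rfl) j
  · rwa [Equiv.swap_apply_right] at hswap
  · rw [Equiv.swap_apply_def]
    split_ifs with hi hj
    · rw [hi, h]
    · rw [hj, h]
    · rfl


/-- Continuity of PiCCE: if `Φ : ℝ^{K+J} → ℝ^{K+J}` is continuous and
symmetric w.r.t. its last `J` inputs, `S ⊆ Fin J` is a fixed nonempty subset, and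
`τ θ` always lies in `S` and attains `max_{j ∈ S} θ_{K+j}`, then for every class `y`
the map `θ ↦ Φ(θ)_y + Φ(θ)_{K+τ(θ)}` is continuous. -/
theorem stmt1
    {K J : ℕ} (hK : 0 < K) (hJ : 0 < J)
    (Φ : (Fin (K + J) → ℝ) → (Fin (K + J) → ℝ))
    (hΦcont : Continuous Φ)
    (hΦsym : ∀ (θ θ' : Fin (K + J) → ℝ) (ρ : Equiv.Perm (Fin J)),
      (∀ j : Fin J, θ' (Fin.natAdd K (ρ j)) = θ (Fin.natAdd K j)) →
      (∀ y : Fin K, θ' (Fin.castAdd J y) = θ (Fin.castAdd J y)) →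
      (∀ j : Fin J, Φ θ' (Fin.natAdd K (ρ j)) = Φ θ (Fin.natAdd K j)) ∧
      (∀ y : Fin K, Φ θ' (Fin.castAdd J y) = Φ θ (Fin.castAdd J y)))
    (S : Finset (Fin J)) (hS : S.Nonempty)
    (τ : (Fin (K + J) → ℝ) → Fin J)
    (hτ : ∀ θ : Fin (K + J) → ℝ, τ θ ∈ S ∧
      θ (Fin.natAdd K (τ θ)) = S.sup' hS (fun j => θ (Fin.natAdd K j))) :
    ∀ y : Fin K,
      Continuous (fun θ : Fin (K + J) → ℝ =>
        Φ θ (Fin.castAdd J y) + Φ θ (Fin.natAdd K (τ θ))) := by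
  intro y
  refine ((continuous_apply _).comp hΦcont).add ?_
  let F : S → Set (Fin (K + J) → ℝ) := fun j =>
    {θ | ∀ i ∈ S, θ (Fin.natAdd K i) ≤ θ (Fin.natAdd K (j : Fin J))}
  have le_tau (θ : Fin (K + J) → ℝ) (i : Fin J) (hi : i ∈ S) :
      θ (Fin.natAdd K i) ≤ θ (Fin.natAdd K (τ θ)) := by
    rw [(hτ θ).2]
    exact Finset.le_sup' (fun j => θ (Fin.natAdd K j)) hi
  refine (locallyFinite_of_finite F).continuous ?_ (fun j => ?_) (fun j => ?_)
  · exact Set.eq_univ_of_forall fun θ =>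
      Set.mem_iUnion.2 ⟨⟨τ θ, (hτ θ).1⟩, fun i hi => le_tau θ i hi⟩
  · simp only [F, Set.ofPred_forall]
    exact isClosed_biInter fun i _ => isClosed_le (continuous_apply _) (continuous_apply _)
  · refine ((continuous_apply (Fin.natAdd K (j : Fin J))).comp hΦcont).continuousOn.congr
      fun θ hθ => ?_
    exact symmetric_apply_eq_of_apply_eq
      (fun θ θ' ρ h₁ h₂ => (hΦsym θ θ' ρ h₁ h₂).1)
      (le_antisymm (hθ _ (hτ θ).1) (le_tau θ j j.2))
end

section
/- Let Φ : ℝ^{K+J} → ℝ^{K+J} be symmetric with respect to the last J inputs and fix θ ∈ ℝ^{K+J}. Let jsel : Ω → Fin J be any function such that for every ω with S(ω) ≠ ∅: jsel(ω) ∈ S(ω) and θ_{K+jsel(ω)} = max_{i ∈ S(ω)} θ_{K+i}. Then for every bijection σ : Fin J → Fin J with θ_{K+σ(i)} ≥ θ_{K+σ(i')} whenever i ≤ i' (a descending sorting of the expert scores), the PiCCE conditional risk satisfies: Σ_ω μ(ω)·[Φ(θ)_{Y ω} + (Φ(θ)_{K+jsel(ω)} if S(ω) ≠ ∅, else 0)]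 = Σ_{y ∈ Fin K} η_y Φ(θ)_y + Σ_{i ∈ Fin J} A_σ^i Φ(θ)_{K+σ(i)}. -/
open Finset

/-- A sum over a finite linear order restricted to the first index satisfying `p` is the value
at that index. -/
theorem sum_ite_first_eq {ι : Type*} [Fintype ι] [LinearOrder ι] (p : ι → Prop)
    [∀ i, Decidable (p i ∧ ∀ i' : ι, i' < i → ¬ p i')] (f : ι → ℝ) {i₀ : ι}
    (h₀ : p i₀) (hmin : ∀ i' : ι, i' < i₀ → ¬ p i') :
    ∑ i, (if p i ∧ ∀ i' : ι, i' < i → ¬ p i' then f i else 0) = f i₀ := by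
  rw [Finset.sum_eq_single i₀, if_pos ⟨h₀, hmin⟩]
  · rintro i - hne
    refine if_neg fun h => ?_
    rcases lt_or_gt_of_ne hne with hlt | hlt
    · exact hmin i hlt h.1
    · exact h.2 i₀ hlt h₀
  · exact fun h => absurd (mem_univ i₀) h

/-- A loss that is symmetric in its last `J` inputs takes equal values at experts with equal
scores. -/
theorem eq_of_symmetric_of_score_eq {K J : ℕ}
    {Φ : (Fin (K + J) → ℝ) → (Fin (K + J) → ℝ)}
    (hΦ : ∀ (θ θ' : Fin (K + J) → ℝ) (ρ : Equiv.Perm (Fin J)),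
      (∀ j : Fin J, θ' (Fin.natAdd K (ρ j)) = θ (Fin.natAdd K j)) →
      (∀ y : Fin K, θ' (Fin.castAdd J y) = θ (Fin.castAdd J y)) →
      ∀ j : Fin J, Φ θ' (Fin.natAdd K (ρ j)) = Φ θ (Fin.natAdd K j))
    {θ : Fin (K + J) → ℝ} {a b : Fin J}
    (hab : θ (Fin.natAdd K a) = θ (Fin.natAdd K b)) :
    Φ θ (Fin.natAdd K a) = Φ θ (Fin.natAdd K b) := by
  have h := hΦ θ θ (Equiv.swap a b) (fun j => ?_) (fun _ => rfl) b
  · rwa [Equiv.swap_apply_right] at h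
  · rcases eq_or_ne j a with rfl | hja
    · rw [Equiv.swap_apply_left, hab]
    rcases eq_or_ne j b with rfl | hjb
    · rw [Equiv.swap_apply_right, hab]
    rw [Equiv.swap_apply_of_ne_of_ne hja hjb]

/-- Risk of PiCCE: for a fixed score vector `θ` and a symmetric loss
encoder `Φ`, a selector `jsel` picking a correct expert of maximal score, and a
descending sorting `σ` of the expert scores, the PiCCE conditional risk decomposes as
`Σ_y η_y Φ(θ)_y + Σ_i A_σ^i Φ(θ)_{K+σ(i)}`. -/
theorem stmt3
    {K J : ℕ} (hK : 0 < K) (hJ : 0 < J)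
    {Ω : Type*} [Fintype Ω] [Nonempty Ω]
    (μ : Ω → ℝ) (hμ : ∀ ω, 0 ≤ μ ω) (hsum : ∑ ω, μ ω = 1)
    (Y : Ω → Fin K) (M : Fin J → Ω → Fin K)
    (Φ : (Fin (K + J) → ℝ) → (Fin (K + J) → ℝ))
    (hΦsym : ∀ (θ θ' : Fin (K + J) → ℝ) (ρ : Equiv.Perm (Fin J)),
      (∀ j : Fin J, θ' (Fin.natAdd K (ρ j)) = θ (Fin.natAdd K j)) →
      (∀ y : Fin K, θ' (Fin.castAdd J y) = θ (Fin.castAdd J y)) →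
      (∀ j : Fin J, Φ θ' (Fin.natAdd K (ρ j)) = Φ θ (Fin.natAdd K j)) ∧
      (∀ y : Fin K, Φ θ' (Fin.castAdd J y) = Φ θ (Fin.castAdd J y)))
    (θ : Fin (K + J) → ℝ)
    (jsel : Ω → Fin J)
    (hjsel : ∀ (ω : Ω) (h : (univ.filter (fun j => M j ω = Y ω)).Nonempty),
      jsel ω ∈ univ.filter (fun j => M j ω = Y ω) ∧
      θ (Fin.natAdd K (jsel ω)) =
        (univ.filter (fun j => M j ω = Y ω)).sup' h (fun i => θ (Fin.natAdd K i)))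
    (σ : Equiv.Perm (Fin J))
    (hσ : ∀ i i' : Fin J, i ≤ i' →
      θ (Fin.natAdd K (σ i')) ≤ θ (Fin.natAdd K (σ i))) :
    ∑ ω, μ ω * (Φ θ (Fin.castAdd J (Y ω)) +
        if (univ.filter (fun j => M j ω = Y ω)).Nonempty
        then Φ θ (Fin.natAdd K (jsel ω)) else 0)
      = (∑ y : Fin K,
          (∑ ω ∈ univ.filter (fun ω => Y ω = y), μ ω) * Φ θ (Fin.castAdd J y))
        + ∑ i : Fin J,
            (∑ ω ∈ univ.filter (fun ω =>
              M (σ i) ω = Y ω ∧ ∀ i' : Fin J, i' < i → M (σ i') ω ≠ Y ω), μ ω)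
              * Φ θ (Fin.natAdd K (σ i)) := by
  have hpt : ∀ ω, (if (univ.filter (fun j => M j ω = Y ω)).Nonempty
      then Φ θ (Fin.natAdd K (jsel ω)) else 0) =
      ∑ i : Fin J, if M (σ i) ω = Y ω ∧ ∀ i' : Fin J, i' < i → M (σ i') ω ≠ Y ω
        then Φ θ (Fin.natAdd K (σ i)) else 0 := by
    intro ω
    split_ifs with hne
    · obtain ⟨hmem, hmax⟩ := hjsel ω hne
      have hcorrect : ∃ i, M (σ i) ω = Y ω :=
        ⟨σ.symm (jsel ω), by simpa using hmem⟩
      obtain ⟨i₀, h₀, hmin⟩ := WellFounded.has_min (wellFounded_lt (α := Fin J))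
        {i | M (σ i) ω = Y ω} hcorrect
      have hfirst : ∀ i', i' < i₀ → ¬ M (σ i') ω = Y ω := fun i' hlt h => hmin i' h hlt
      refine Eq.trans ?_ (sum_ite_first_eq (fun i => M (σ i) ω = Y ω)
        (fun i => Φ θ (Fin.natAdd K (σ i))) h₀ hfirst).symm
      refine eq_of_symmetric_of_score_eq (fun θ θ' ρ h h' => (hΦsym θ θ' ρ h h').1)
        (le_antisymm ?_ ?_)
      · have hle : i₀ ≤ σ.symm (jsel ω) :=
          not_lt.mp (hmin (σ.symm (jsel ω)) (by simpa using hmem))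
        simpa using hσ _ _ hle
      · rw [hmax]
        exact le_sup' (fun i => θ (Fin.natAdd K i))
          (b := σ i₀) (mem_filter.mpr ⟨mem_univ _, h₀⟩)
    · refine (sum_eq_zero fun i _ => if_neg fun h => hne ?_).symm
      exact ⟨σ i, mem_filter.mpr ⟨mem_univ _, h.1⟩⟩
  simp_rw [hpt, mul_add, sum_add_distrib, sum_mul, sum_filter, mul_sum, mul_ite, mul_zero]
  congr 1
  · rw [sum_comm]
    simp
  · exact sum_comm
end

section
/- Assume η_y > 0 for every y ∈ Fin K. Then: (i) R_CE attains its minimum on the simplex Δ_{K+J}; (ii) every minimizer q* of R_CE on Δ_{K+J} satisfies q*_y = η_y/(1+V) for every class coordinate y ∈ Fin K, and consequently Σ_{j ∈ Fin J} q*_{⊥j} = V/(1+V); (iii) in particular, every class index y maximizing q*_y over Fin K also maximizes η_y over Fin K. -/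
open Finset

noncomputable section

/-- `negLog x = -log x`, valued in `EReal`, with the convention `-log 0 = +∞`. -/
def negLog (x : ℝ) : EReal := if x = 0 then ⊤ else ((-Real.log x : ℝ) : EReal)

/-- The PiCCE cross-entropy conditional risk
`R_CE(q) = Σ_ω μ(ω)·[−log q_{Y ω} + (−log(max_{j ∈ S(ω)} q_{⊥j}) if S(ω) ≠ ∅ else 0)]`,
valued in `EReal`, where `S(ω)` is the set of experts correct at `ω`.
(`0 · ⊤ = 0` holds in `EReal`, so terms with `μ ω = 0` contribute `0`.) -/
def RCE {K J : ℕ} {Ω : Type*} [Fintype Ω]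
    (μ : Ω → ℝ) (Y : Ω → Fin K) (M : Fin J → Ω → Fin K)
    (q : Fin K ⊕ Fin J → ℝ) : EReal :=
  ∑ ω, (μ ω : EReal) *
    (negLog (q (Sum.inl (Y ω))) +
      if h : (univ.filter (fun j => M j ω = Y ω)).Nonempty
      then negLog ((univ.filter (fun j => M j ω = Y ω)).sup' h (fun j => q (Sum.inr j)))
      else 0)

/-- The probability simplex on `Fin K ⊕ Fin J`. -/
def simplex (K J : ℕ) : Set (Fin K ⊕ Fin J → ℝ) :=
  {q | (∀ c, 0 ≤ q c) ∧ ∑ c, q c = 1}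

lemma negLog_one : negLog 1 = 0 := by simp [negLog]

lemma negLog_mul (x y : ℝ) : negLog (x * y) = negLog x + negLog y := by
  unfold negLog
  by_cases hx : x = 0
  · by_cases hy : y = 0 <;> simp [hx, hy]
  · by_cases hy : y = 0
    · simp only [hy, mul_zero, hx, if_true, if_false]
      exact (EReal.coe_add_top _).symm
    · simp only [mul_eq_zero, hx, hy, or_self, if_false, Real.log_mul hx hy, neg_add]
      exact EReal.coe_add _ _

lemma negLog_rpow {x a : ℝ} (hx : 0 ≤ x) (ha : 0 ≤ a) :
    negLog (x ^ a) = (a : EReal) * negLog x := by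
  rcases ha.eq_or_lt with rfl | ha
  · simp [negLog_one]
  rcases hx.eq_or_lt with rfl | hx
  · simp [negLog, Real.zero_rpow ha.ne', EReal.coe_mul_top_of_pos ha]
  · have h := (Real.rpow_pos_of_pos hx a).ne'
    simp only [negLog, h, hx.ne', if_false, Real.log_rpow hx]
    rw [← EReal.coe_mul, mul_neg]

lemma negLog_prod {ι : Type*} (s : Finset ι) (f : ι → ℝ) :
    negLog (∏ i ∈ s, f i) = ∑ i ∈ s, negLog (f i) := by
  classical
  induction s using Finset.induction_on with
  | empty => simp [negLog_one]
  | insert a s ha ih => rw [prod_insert ha, sum_insert ha, negLog_mul, ih]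

lemma negLog_le_negLog_iff {x y : ℝ} (hx : 0 ≤ x) (hy : 0 ≤ y) :
    negLog x ≤ negLog y ↔ y ≤ x := by
  unfold negLog
  rcases hx.eq_or_lt with rfl | hx
  · rcases hy.eq_or_lt with rfl | hy
    · simp
    · simp [hy.ne', hy]
  · rcases hy.eq_or_lt with rfl | hy
    · simp [hx.le]
    · simp only [hx.ne', hy.ne', if_false, EReal.coe_le_coe_iff, neg_le_neg_iff]
      exact Real.log_le_log_iff hy hx

/-- The largest weight of an expert correct at `ω`, or `1` if no expert is correct. -/
def bestExpert {K J : ℕ} {Ω : Type*} (Y : Ω → Fin K) (M : Fin J → Ω → Fin K)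
    (r : Fin J → ℝ) (ω : Ω) : ℝ :=
  if h : (univ.filter (fun j => M j ω = Y ω)).Nonempty
  then (univ.filter (fun j => M j ω = Y ω)).sup' h r else 1

/-- The likelihood of the expert coordinates. -/
def expertLikelihood {K J : ℕ} {Ω : Type*} [Fintype Ω] (μ : Ω → ℝ) (Y : Ω → Fin K)
    (M : Fin J → Ω → Fin K) (r : Fin J → ℝ) : ℝ :=
  ∏ ω, bestExpert Y M r ω ^ μ ω

section

variable {K J : ℕ} {Ω : Type*} (Y : Ω → Fin K) (M : Fin J → Ω → Fin K)

lemma bestExpert_nonneg {r : Fin J → ℝ} (hr : ∀ j, 0 ≤ r j) (ω : Ω) :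
    0 ≤ bestExpert Y M r ω := by
  unfold bestExpert
  split_ifs with h
  · obtain ⟨j, hj⟩ := h
    exact (hr j).trans (le_sup' r hj)
  · exact zero_le_one

lemma bestExpert_pos {r : Fin J → ℝ} (hr : ∀ j, 0 < r j) (ω : Ω) :
    0 < bestExpert Y M r ω := by
  unfold bestExpert
  split_ifs with h
  · obtain ⟨j, hj⟩ := h
    exact (hr j).trans_le (le_sup' r hj)
  · exact one_pos

lemma continuous_bestExpert (ω : Ω) : Continuous fun r => bestExpert Y M r ω := by
  unfold bestExpert
  split_ifs with h
  · exact Continuous.finset_sup'_apply h fun j _ => continuous_apply j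
  · exact continuous_const

lemma bestExpert_zero_of_exists {ω : Ω} (h : ∃ j, M j ω = Y ω) :
    bestExpert Y M (fun _ => 0) ω = 0 := by
  obtain ⟨j, hj⟩ := h
  have h' : (univ.filter (fun j => M j ω = Y ω)).Nonempty := ⟨j, by simp [hj]⟩
  simp [bestExpert, h']

lemma bestExpert_smul {t : ℝ} (ht : 0 ≤ t) (r : Fin J → ℝ) (ω : Ω) :
    bestExpert Y M (fun j => t * r j) ω =
      (if ∃ j, M j ω = Y ω then t else 1) * bestExpert Y M r ω := by
  unfold bestExpert
  by_cases h : ∃ j, M j ω = Y ω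
  · have h' : (univ.filter (fun j => M j ω = Y ω)).Nonempty := by
      obtain ⟨j, hj⟩ := h
      exact ⟨j, by simp [hj]⟩
    simp only [h, h', dif_pos, if_true]
    exact (apply_sup'_eq_sup'_comp h' (fun x => t * x)
      fun x y => mul_max_of_nonneg x y ht).symm
  · have h' : ¬ (univ.filter (fun j => M j ω = Y ω)).Nonempty := by
      rintro ⟨j, hj⟩
      exact h ⟨j, by simpa using hj⟩
    simp [h, h']

variable [Fintype Ω] {μ : Ω → ℝ}

lemma expertLikelihood_nonneg {r : Fin J → ℝ} (hr : ∀ j, 0 ≤ r j) :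
    0 ≤ expertLikelihood μ Y M r :=
  prod_nonneg fun ω _ => Real.rpow_nonneg (bestExpert_nonneg Y M hr ω) _

lemma expertLikelihood_pos {r : Fin J → ℝ} (hr : ∀ j, 0 < r j) :
    0 < expertLikelihood μ Y M r :=
  prod_pos fun ω _ => Real.rpow_pos_of_pos (bestExpert_pos Y M hr ω) _

lemma continuous_expertLikelihood (hμ : ∀ ω, 0 ≤ μ ω) :
    Continuous (expertLikelihood μ Y M) :=
  continuous_finsetProd _ fun ω _ =>
    (continuous_bestExpert Y M ω).rpow_const fun _ => Or.inr (hμ ω)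

lemma expertLikelihood_smul (hμ : ∀ ω, 0 ≤ μ ω) {t : ℝ} (ht : 0 ≤ t)
    {r : Fin J → ℝ} (hr : ∀ j, 0 ≤ r j) :
    expertLikelihood μ Y M (fun j => t * r j) =
      t ^ (∑ ω ∈ univ.filter (fun ω => ∃ j, M j ω = Y ω), μ ω) *
        expertLikelihood μ Y M r := by
  unfold expertLikelihood
  rw [Real.rpow_sum_of_nonneg ht fun ω _ => hμ ω, prod_filter, ← prod_mul_distrib]
  refine prod_congr rfl fun ω _ => ?_
  rw [bestExpert_smul Y M ht]
  split_ifs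
  · exact Real.mul_rpow ht (bestExpert_nonneg Y M hr ω)
  · simp

lemma sum_correct_eq_zero_of_expertLikelihood_zero_ne_zero
    (h : expertLikelihood μ Y M (fun _ => 0) ≠ 0) :
    ∑ ω ∈ univ.filter (fun ω => ∃ j, M j ω = Y ω), μ ω = 0 := by
  refine sum_eq_zero fun ω hω => ?_
  by_contra hne
  refine h (prod_eq_zero (mem_univ ω) ?_)
  rw [bestExpert_zero_of_exists Y M (by simpa using hω), Real.zero_rpow hne]

lemma prod_rpow_eq_prod_fiber (hμ : ∀ ω, 0 ≤ μ ω) {a : Fin K → ℝ} (ha : ∀ y, 0 ≤ a y) :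
    ∏ ω, a (Y ω) ^ μ ω = ∏ y, a y ^ (∑ ω ∈ univ.filter (fun ω => Y ω = y), μ ω) := by
  rw [← prod_fiberwise univ Y]
  refine prod_congr rfl fun y _ => ?_
  rw [Real.rpow_sum_of_nonneg (ha y) fun ω _ => hμ ω]
  refine prod_congr rfl fun ω hω => ?_
  rw [(mem_filter.mp hω).2]

lemma RCE_eq_negLog (hμ : ∀ ω, 0 ≤ μ ω) {q : Fin K ⊕ Fin J → ℝ} (hq : ∀ c, 0 ≤ q c) :
    RCE μ Y M q = negLog ((∏ y, q (Sum.inl y) ^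
      (∑ ω ∈ univ.filter (fun ω => Y ω = y), μ ω)) *
        expertLikelihood μ Y M (fun j => q (Sum.inr j))) := by
  rw [← prod_rpow_eq_prod_fiber Y hμ fun y => hq (Sum.inl y), expertLikelihood,
    ← prod_mul_distrib, negLog_prod]
  refine sum_congr rfl fun ω _ => ?_
  have hb := bestExpert_nonneg Y M (fun j => hq (Sum.inr j)) ω
  rw [← Real.mul_rpow (hq _) hb, negLog_rpow (mul_nonneg (hq _) hb) (hμ ω), negLog_mul]
  congr 2
  unfold bestExpert
  split_ifs
  · rfl
  · exact negLog_one.symm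

end

/-- Uniqueness in Gibbs' inequality, with the unnormalised weights `η` and `V`. -/
lemma eq_of_prod_rpow_le {ι : Type*} [Fintype ι] {η a : ι → ℝ} {V s : ℝ}
    (hη : ∀ i, 0 < η i) (hη1 : ∑ i, η i = 1) (ha : ∀ i, 0 < a i) (hV : 0 ≤ V)
    (hs : 0 ≤ s) (hsV : s = 0 → V = 0) (hsum : ∑ i, a i + s = 1)
    (h : (∏ i, (η i / (1 + V)) ^ η i) * (V / (1 + V) / s) ^ V ≤ ∏ i, a i ^ η i) (i : ι) :
    a i = η i / (1 + V) := by
  have hV1 : 0 < 1 + V := by linarith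
  have hp : ∀ i, 0 < η i / (1 + V) := fun i => div_pos (hη i) hV1
  have ht : 0 < (V / (1 + V) / s) ^ V := by
    rcases hV.eq_or_lt with rfl | hV
    · simp
    · have hs' : 0 < s := hs.lt_of_ne fun h0 => hV.ne' (hsV h0.symm)
      positivity
  have hP : 0 < ∏ i, (η i / (1 + V)) ^ η i :=
    prod_pos fun i _ => Real.rpow_pos_of_pos (hp i) _
  have hlog := Real.log_le_log (mul_pos hP ht) h
  rw [Real.log_mul hP.ne' ht.ne',
    Real.log_prod fun i _ => (Real.rpow_pos_of_pos (hp i) _).ne',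
    Real.log_prod fun i _ => (Real.rpow_pos_of_pos (ha i) _).ne'] at hlog
  simp only [Real.log_rpow (hp _), Real.log_rpow (ha _)] at hlog
  have hexp : -Real.log ((V / (1 + V) / s) ^ V) ≤ (1 + V) * s - V := by
    rcases hV.eq_or_lt with rfl | hV
    · simpa using hs
    · have hs' : 0 < s := hs.lt_of_ne fun h0 => hV.ne' (hsV h0.symm)
      have hpos : 0 < V / (1 + V) / s := by positivity
      have hle := Real.log_le_sub_one_of_pos (inv_pos.mpr hpos)
      rw [Real.log_inv] at hle
      rw [Real.log_rpow hpos]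
      have hmul := mul_le_mul_of_nonneg_left hle hV.le
      have heq : V * ((V / (1 + V) / s)⁻¹ - 1) = (1 + V) * s - V := by field_simp
      linarith
  have hlt : ∀ i, a i ≠ η i / (1 + V) →
      η i * Real.log (a i) - η i * Real.log (η i / (1 + V)) < (1 + V) * a i - η i := by
    intro i hi
    have hl := Real.log_lt_sub_one_of_pos (div_pos (ha i) (hp i))
      fun h1 => hi ((div_eq_one_iff_eq (hp i).ne').mp h1)
    rw [Real.log_div (ha i).ne' (hp i).ne'] at hl
    have hmul := mul_lt_mul_of_pos_left hl (hη i)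
    have heq : η i * (a i / (η i / (1 + V)) - 1) = (1 + V) * a i - η i := by
      have := (hη i).ne'
      field_simp
    linarith
  have hle : ∀ i,
      η i * Real.log (a i) - η i * Real.log (η i / (1 + V)) ≤ (1 + V) * a i - η i := by
    intro i
    by_cases hi : a i = η i / (1 + V)
    · rw [hi, sub_self, mul_div_cancel₀ _ hV1.ne', sub_self]
    · exact (hlt i hi).le
  by_contra hi
  have hstrict := sum_lt_sum (fun i _ => hle i) ⟨i, mem_univ i, hlt i hi⟩
  rw [sum_sub_distrib, sum_sub_distrib, ← mul_sum, hη1] at hstrict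
  have : (1 + V) * (∑ i, a i + s) = 1 + V := by rw [hsum, mul_one]
  linarith

/-- assuming every class has positive probability, (i) `R_CE` attains its
minimum on the simplex; (ii) every minimizer `q*` satisfies `q*_y = η_y/(1+V)` for all
classes `y`, hence `Σ_j q*_{⊥j} = V/(1+V)`; (iii) any class index maximizing `q*_y`
also maximizes `η_y`. -/
theorem stmt5
    {K J : ℕ} (hK : 0 < K) (hJ : 0 < J)
    {Ω : Type*} [Fintype Ω] [Nonempty Ω]
    (μ : Ω → ℝ) (hμ : ∀ ω, 0 ≤ μ ω) (hsum : ∑ ω, μ ω = 1)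
    (Y : Ω → Fin K) (M : Fin J → Ω → Fin K)
    (η : Fin K → ℝ) (hη : ∀ y, η y = ∑ ω ∈ univ.filter (fun ω => Y ω = y), μ ω)
    (V : ℝ) (hV : V = ∑ ω ∈ univ.filter (fun ω => ∃ j : Fin J, M j ω = Y ω), μ ω)
    (hηpos : ∀ y : Fin K, 0 < η y) :
    (∃ q ∈ simplex K J, ∀ q' ∈ simplex K J, RCE μ Y M q ≤ RCE μ Y M q') ∧
    (∀ q ∈ simplex K J, (∀ q' ∈ simplex K J, RCE μ Y M q ≤ RCE μ Y M q') →
      (∀ y : Fin K, q (Sum.inl y) = η y / (1 + V)) ∧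
      (∑ j : Fin J, q (Sum.inr j) = V / (1 + V)) ∧
      (∀ y : Fin K, (∀ y' : Fin K, q (Sum.inl y') ≤ q (Sum.inl y)) →
        ∀ y' : Fin K, η y' ≤ η y)) := by
  classical
  have hV0 : 0 ≤ V := hV ▸ sum_nonneg fun ω _ => hμ ω
  have hV1 : 0 < 1 + V := by linarith
  have hη1 : ∑ y, η y = 1 := by
    simp only [hη]
    rw [sum_fiberwise, hsum]
  set L : (Fin K ⊕ Fin J → ℝ) → ℝ := fun q =>
    (∏ y, q (Sum.inl y) ^ η y) * expertLikelihood μ Y M (fun j => q (Sum.inr j)) with hL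
  have hLnonneg : ∀ q ∈ simplex K J, 0 ≤ L q := fun q hq =>
    mul_nonneg (prod_nonneg fun y _ => Real.rpow_nonneg (hq.1 _) _)
      (expertLikelihood_nonneg Y M fun j => hq.1 _)
  have hRCE : ∀ q ∈ simplex K J, RCE μ Y M q = negLog (L q) := by
    intro q hq
    simp only [hL, hη]
    exact RCE_eq_negLog Y M hμ hq.1
  have hle : ∀ q ∈ simplex K J, ∀ q' ∈ simplex K J,
      (RCE μ Y M q ≤ RCE μ Y M q' ↔ L q' ≤ L q) := fun q hq q' hq' => by
    rw [hRCE q hq, hRCE q' hq', negLog_le_negLog_iff (hLnonneg q hq) (hLnonneg q' hq')]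
  have hcont : Continuous L := by
    refine Continuous.mul (continuous_finsetProd _ fun y _ => ?_) ?_
    · exact (continuous_apply _).rpow_const fun _ => Or.inr (hηpos y).le
    · exact (continuous_expertLikelihood Y M hμ).comp
        (continuous_pi fun j => continuous_apply _)
  have hcard : (0 : ℝ) < K + J := by positivity
  obtain ⟨u, hu, hupos⟩ : ∃ u ∈ simplex K J, 0 < L u := by
    have hc : (0 : ℝ) < 1 / (K + J) := by positivity
    refine ⟨fun _ => 1 / (K + J), ⟨fun _ => hc.le, ?_⟩, ?_⟩
    · simp [mul_inv_cancel₀ hcard.ne']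
    · exact mul_pos (prod_pos fun y _ => Real.rpow_pos_of_pos hc _)
        (expertLikelihood_pos Y M fun _ => hc)
  refine ⟨?_, fun q hq hmin => ?_⟩
  · have hcomp : IsCompact (simplex K J) := isCompact_stdSimplex ℝ (Fin K ⊕ Fin J)
    obtain ⟨q, hq, hmax⟩ := hcomp.exists_isMaxOn ⟨u, hu⟩ hcont.continuousOn
    exact ⟨q, hq, fun q' hq' => (hle q hq q' hq').mpr (hmax hq')⟩
  have hmax : ∀ q' ∈ simplex K J, L q' ≤ L q := fun q' hq' =>
    (hle q hq q' hq').mp (hmin q' hq')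
  have hLpos : 0 < L q := hupos.trans_le (hmax u hu)
  have hEpos : 0 < expertLikelihood μ Y M (fun j => q (Sum.inr j)) :=
    (expertLikelihood_nonneg Y M fun j => hq.1 _).lt_of_ne' (right_ne_zero_of_mul hLpos.ne')
  have hapos : ∀ y, 0 < q (Sum.inl y) := by
    refine fun y => (hq.1 _).lt_of_ne' fun h0 => left_ne_zero_of_mul hLpos.ne' ?_
    exact prod_eq_zero (mem_univ y) (by rw [h0, Real.zero_rpow (hηpos y).ne'])
  have hs0 : 0 ≤ ∑ j, q (Sum.inr j) := sum_nonneg fun j _ => hq.1 _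
  have hsum1 : ∑ y, q (Sum.inl y) + ∑ j, q (Sum.inr j) = 1 := by
    rw [← Fintype.sum_sum_type]
    exact hq.2
  have hsV : ∑ j, q (Sum.inr j) = 0 → V = 0 := by
    intro h0
    have hz : (fun j => q (Sum.inr j)) = fun _ => 0 := funext fun j =>
      (sum_eq_zero_iff_of_nonneg fun j _ => hq.1 _).mp h0 j (mem_univ j)
    rw [hV]
    exact sum_correct_eq_zero_of_expertLikelihood_zero_ne_zero Y M (hz ▸ hEpos.ne')
  have hclass : ∀ y, q (Sum.inl y) = η y / (1 + V) := by
    refine eq_of_prod_rpow_le hηpos hη1 hapos hV0 hs0 hsV hsum1 ?_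
    set s := ∑ j, q (Sum.inr j) with hs
    have ht : 0 ≤ V / (1 + V) / s := by positivity
    have hts : V / (1 + V) / s * s = V / (1 + V) := by
      by_cases h0 : s = 0
      · simp [hsV h0]
      · exact div_mul_cancel₀ _ h0
    have hmem : Sum.elim (fun y => η y / (1 + V))
        (fun j => V / (1 + V) / s * q (Sum.inr j)) ∈ simplex K J := by
      constructor
      · rintro (y | j)
        · exact (div_pos (hηpos y) hV1).le
        · exact mul_nonneg ht (hq.1 _)
      · simp only [Fintype.sum_sum_type, Sum.elim_inl, Sum.elim_inr]
        rw [← mul_sum, ← hs, hts, ← sum_div, hη1, ← add_div, div_self hV1.ne']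
    have hcmp := hmax _ hmem
    simp only [hL, Sum.elim_inl, Sum.elim_inr] at hcmp
    rw [expertLikelihood_smul Y M hμ ht fun j => hq.1 _, ← hV, ← mul_assoc] at hcmp
    exact le_of_mul_le_mul_right hcmp hEpos
  refine ⟨hclass, ?_, fun y hy y' => ?_⟩
  · simp only [hclass] at hsum1
    rw [← sum_div, hη1] at hsum1
    rw [← eq_sub_iff_add_eq'] at hsum1
    rw [hsum1]
    field_simp
    ring
  · have h := hy y'
    rwa [hclass, hclass, div_le_div_iff_of_pos_right hV1] at h
end
end

section
/- Assume 0 < η_y < 1 for every y ∈ Fin K. Then R_OvA attains its minimum on [0,1]^K × [0,1]^J, and every minimizer (s*, u*) of R_OvA satisfies s*_y = η_y for every y ∈ Fin K; in particular, every class index y maximizing s*_y over Fin K also maximizes η_y over Fin K. -/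
open Finset

noncomputable section

/-- The PiCCE one-vs-all conditional risk, for a given tie-breaking selector `jhat`
(which may depend on the expert-score vector `u`):
`R_OvA(s,u) = Σ_ω μ(ω)·[ −log s_{Yω} − Σ_{y ≠ Yω} log(1−s_y)
  + (−log u_{ĵ(ω)} − Σ_{j ≠ ĵ(ω)} log(1−u_j) if S(ω) ≠ ∅ else −Σ_j log(1−u_j)) ]`. -/
def ROvA {K J : ℕ} {Ω : Type*} [Fintype Ω]
    (μ : Ω → ℝ) (Y : Ω → Fin K) (M : Fin J → Ω → Fin K)
    (jhat : (Fin J → ℝ) → Ω → Fin J)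
    (s : Fin K → ℝ) (u : Fin J → ℝ) : EReal :=
  ∑ ω, (μ ω : EReal) *
    ((negLog (s (Y ω)) + ∑ y ∈ univ.erase (Y ω), negLog (1 - s y)) +
      if (univ.filter (fun j => M j ω = Y ω)).Nonempty
      then negLog (u (jhat u ω)) + ∑ j ∈ univ.erase (jhat u ω), negLog (1 - u j)
      else ∑ j : Fin J, negLog (1 - u j))

/-- The box `[0,1]^K × [0,1]^J` of one-vs-all scores. -/
def ovaBox (K J : ℕ) : Set ((Fin K → ℝ) × (Fin J → ℝ)) :=
  {p | (∀ y, p.1 y ∈ Set.Icc (0 : ℝ) 1) ∧ ∀ j, p.2 j ∈ Set.Icc (0 : ℝ) 1}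

lemma negLog_nonneg {x : ℝ} (h0 : 0 ≤ x) (h1 : x ≤ 1) : 0 ≤ negLog x := by
  unfold negLog
  split_ifs
  · exact le_top
  · exact_mod_cast neg_nonneg.2 (Real.log_nonpos h0 h1)

lemma negLog_le_negLog {x y : ℝ} (hx : 0 ≤ x) (hxy : x ≤ y) : negLog y ≤ negLog x := by
  unfold negLog
  by_cases h : x = 0
  · simp [h]
  · have hx' : 0 < x := lt_of_le_of_ne hx (Ne.symm h)
    rw [if_neg h, if_neg (hx'.trans_le hxy).ne']
    exact_mod_cast neg_le_neg (Real.log_le_log hx' hxy)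

lemma EReal.coe_mul_sum_of_nonneg {ι : Type*} {a : ℝ} (F : Finset ι) (f : ι → EReal)
    (hf : ∀ i, 0 ≤ f i) : (a : EReal) * ∑ i ∈ F, f i = ∑ i ∈ F, (a : EReal) * f i := by
  classical
  induction F using Finset.induction_on with
  | empty => simp
  | insert i F hi ih =>
    rw [sum_insert hi, sum_insert hi, ← ih,
      EReal.left_distrib_of_nonneg (hf i) (sum_nonneg fun j _ => hf j)]

lemma EReal.sum_coe_mul_of_nonneg {ι : Type*} (F : Finset ι) (f : ι → ℝ) (hf : ∀ i, 0 ≤ f i)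
    (c : EReal) : ∑ i ∈ F, (f i : EReal) * c = ((∑ i ∈ F, f i : ℝ) : EReal) * c := by
  classical
  induction F using Finset.induction_on with
  | empty => simp
  | insert i F hi ih =>
    rw [sum_insert hi, sum_insert hi, ih, EReal.coe_add, EReal.right_distrib_of_nonneg
      (by exact_mod_cast hf i) (by exact_mod_cast sum_nonneg fun j _ => hf j)]

/-- Binary cross-entropy of the score `t` against the frequency `a`. -/
def binCrossEntropy (a t : ℝ) : EReal :=
  (a : EReal) * negLog t + ((1 - a : ℝ) : EReal) * negLog (1 - t)

lemma binCrossEntropy_self (a : ℝ) : binCrossEntropy a a = (Real.binEntropy a : EReal) := by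
  have key : ∀ x : ℝ, (x : EReal) * negLog x = ((x * Real.log x⁻¹ : ℝ) : EReal) := by
    intro x
    by_cases hx : x = 0
    · simp [hx]
    · simp [negLog, hx]
  rw [binCrossEntropy, key, key, Real.binEntropy, EReal.coe_add]

lemma binEntropy_lt_cross {a t : ℝ} (ha0 : 0 ≤ a) (ha1 : a ≤ 1) (ht0 : 0 < t) (ht1 : t < 1)
    (hne : t ≠ a) :
    Real.binEntropy a < a * -Real.log t + (1 - a) * -Real.log (1 - t) := by
  rcases ha0.eq_or_lt with rfl | ha0
  · have := Real.log_neg (x := 1 - t) (by linarith) (by linarith)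
    simpa using this
  rcases ha1.eq_or_lt with rfl | ha1
  · have := Real.log_neg ht0 ht1
    simpa using this
  have ha1' : 0 < 1 - a := by linarith
  have ht1' : 0 < 1 - t := by linarith
  have h1 := Real.log_lt_sub_one_of_pos (div_pos ht0 ha0)
    (fun h => hne ((div_eq_one_iff_eq ha0.ne').1 h))
  have h2 := Real.log_le_sub_one_of_pos (div_pos ht1' ha1')
  rw [Real.log_div ht0.ne' ha0.ne'] at h1
  rw [Real.log_div ht1'.ne' ha1'.ne'] at h2
  have h1' := mul_lt_mul_of_pos_left h1 ha0
  have h2' := mul_le_mul_of_nonneg_left h2 ha1'.le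
  have e1 : a * (t / a - 1) = t - a := by field_simp
  have e2 : (1 - a) * ((1 - t) / (1 - a) - 1) = a - t := by field_simp; ring
  rw [e1] at h1'
  rw [e2] at h2'
  rw [Real.binEntropy, Real.log_inv, Real.log_inv]
  linarith

lemma binCrossEntropy_self_lt {a t : ℝ} (ha : a ∈ Set.Icc (0 : ℝ) 1)
    (ht : t ∈ Set.Icc (0 : ℝ) 1) (hne : t ≠ a) : binCrossEntropy a a < binCrossEntropy a t := by
  rw [binCrossEntropy_self]
  obtain ⟨ha0, ha1⟩ := ha
  obtain ⟨ht0, ht1⟩ := ht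
  rcases ht0.eq_or_lt with rfl | ht0
  · have h : 0 < a := lt_of_le_of_ne ha0 hne
    simp [binCrossEntropy, negLog, EReal.coe_mul_top_of_pos h]
  rcases ht1.eq_or_lt with rfl | ht1
  · have h : 0 < 1 - a := sub_pos.2 (lt_of_le_of_ne ha1 (Ne.symm hne))
    simp only [binCrossEntropy, negLog, sub_self, if_true, one_ne_zero, if_false,
      EReal.coe_mul_top_of_pos h, Real.log_one, neg_zero, EReal.coe_zero, mul_zero, zero_add]
    exact EReal.coe_lt_top _
  · have ht1' : 1 - t ≠ 0 := by linarith
    rw [binCrossEntropy, negLog, negLog, if_neg ht0.ne', if_neg ht1']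
    exact_mod_cast binEntropy_lt_cross ha0 ha1 ht0 ht1 hne

lemma binCrossEntropy_self_le {a t : ℝ} (ha : a ∈ Set.Icc (0 : ℝ) 1)
    (ht : t ∈ Set.Icc (0 : ℝ) 1) : binCrossEntropy a a ≤ binCrossEntropy a t := by
  rcases eq_or_ne t a with rfl | hne
  · exact le_rfl
  · exact (binCrossEntropy_self_lt ha ht hne).le

lemma sum_binCrossEntropy_self {ι : Type*} (F : Finset ι) (a : ι → ℝ) :
    ∑ k ∈ F, binCrossEntropy (a k) (a k) = ((∑ k ∈ F, Real.binEntropy (a k) : ℝ) : EReal) := by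
  simp only [binCrossEntropy_self]
  classical
  induction F using Finset.induction_on with
  | empty => simp
  | insert i F hi ih => rw [sum_insert hi, sum_insert hi, ih, EReal.coe_add]

lemma eq_of_sum_binCrossEntropy_le {ι : Type*} [Fintype ι] {a t : ι → ℝ}
    (ha : ∀ k, a k ∈ Set.Icc (0 : ℝ) 1) (ht : ∀ k, t k ∈ Set.Icc (0 : ℝ) 1)
    (h : ∑ k, binCrossEntropy (a k) (t k) ≤ ∑ k, binCrossEntropy (a k) (a k)) (k : ι) :
    t k = a k := by
  classical
  by_contra hne
  refine h.not_gt ?_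
  rw [← add_sum_erase _ _ (mem_univ k), ← add_sum_erase _ _ (mem_univ k)]
  have hle := sum_le_sum fun i (_ : i ∈ univ.erase k) => binCrossEntropy_self_le (ha i) (ht i)
  have hlt := binCrossEntropy_self_lt (ha k) (ht k) hne
  rw [sum_binCrossEntropy_self] at hle ⊢
  calc _ < binCrossEntropy (a k) (t k) + _ := EReal.add_lt_add_right_coe hlt _
    _ ≤ _ := by gcongr

/-- Binary cross-entropy loss of the scores `t` on the set of positive labels `p`. -/
def binLoss {ι : Type*} [Fintype ι] (p : ι → Prop) [DecidablePred p] (t : ι → ℝ) : EReal :=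
  ∑ k, if p k then negLog (t k) else negLog (1 - t k)

lemma binTerm_nonneg {x : ℝ} (hx : x ∈ Set.Icc (0 : ℝ) 1) (p : Prop) [Decidable p] :
    0 ≤ if p then negLog x else negLog (1 - x) := by
  obtain ⟨h0, h1⟩ := hx
  split_ifs
  · exact negLog_nonneg h0 h1
  · exact negLog_nonneg (by linarith) (by linarith)

lemma binLoss_nonneg {ι : Type*} [Fintype ι] (p : ι → Prop) [DecidablePred p] {t : ι → ℝ}
    (ht : ∀ k, t k ∈ Set.Icc (0 : ℝ) 1) : 0 ≤ binLoss p t :=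
  sum_nonneg fun k _ => binTerm_nonneg (ht k) _

lemma binLoss_eq {ι : Type*} [Fintype ι] [DecidableEq ι] (i : ι) (t : ι → ℝ) :
    binLoss (fun k => k = i) t = negLog (t i) + ∑ k ∈ univ.erase i, negLog (1 - t k) := by
  rw [binLoss, ← add_sum_erase _ _ (mem_univ i), if_pos rfl]
  congr 1
  exact sum_congr rfl fun k hk => if_neg (ne_of_mem_erase hk)

lemma binLoss_eq_le {ι : Type*} [Fintype ι] [DecidableEq ι] {i j : ι} {t : ι → ℝ}
    (ht : ∀ k, t k ∈ Set.Icc (0 : ℝ) 1) (hij : t i ≤ t j) :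
    binLoss (fun k => k = j) t ≤ binLoss (fun k => k = i) t := by
  rcases eq_or_ne i j with rfl | hne
  · exact le_rfl
  have hj : j ∈ univ.erase i := mem_erase.2 ⟨hne.symm, mem_univ j⟩
  rw [binLoss, binLoss, ← add_sum_erase _ _ (mem_univ i), ← add_sum_erase _ _ hj,
    ← add_sum_erase univ (fun k => if k = i then _ else _) (mem_univ i),
    ← add_sum_erase (univ.erase i) (fun k => if k = i then _ else _) hj]
  simp only [if_neg hne, if_neg hne.symm, if_true]
  rw [← add_assoc, ← add_assoc, add_comm (negLog (1 - t i))]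
  refine add_le_add (add_le_add (negLog_le_negLog (ht i).1 hij)
    (negLog_le_negLog (by linarith [(ht j).2]) (by linarith))) (le_of_eq ?_)
  refine sum_congr rfl fun k hk => ?_
  rw [if_neg (ne_of_mem_erase hk), if_neg (ne_of_mem_erase (mem_of_mem_erase hk))]

/-- Frequency of the positive label `k`. -/
def posFreq {Ω ι : Type*} [Fintype Ω] (μ : Ω → ℝ) (p : Ω → ι → Prop) [∀ ω, DecidablePred (p ω)] (k : ι) : ℝ :=
  ∑ ω, if p ω k then μ ω else 0

lemma posFreq_mem_Icc {Ω ι : Type*} [Fintype Ω] {μ : Ω → ℝ} (hμ : ∀ ω, 0 ≤ μ ω)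
    (hsum : ∑ ω, μ ω = 1) (p : Ω → ι → Prop) [∀ ω, DecidablePred (p ω)] (k : ι) :
    posFreq μ p k ∈ Set.Icc (0 : ℝ) 1 := by
  refine ⟨sum_nonneg fun ω _ => ?_, hsum ▸ sum_le_sum fun ω _ => ?_⟩ <;>
  · split_ifs <;> simp [hμ]

lemma sum_mul_binLoss {Ω ι : Type*} [Fintype Ω] [Fintype ι] {μ : Ω → ℝ}
    (hμ : ∀ ω, 0 ≤ μ ω) (hsum : ∑ ω, μ ω = 1) (p : Ω → ι → Prop) [∀ ω, DecidablePred (p ω)] {t : ι → ℝ}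
    (ht : ∀ k, t k ∈ Set.Icc (0 : ℝ) 1) :
    ∑ ω, (μ ω : EReal) * binLoss (p ω) t = ∑ k, binCrossEntropy (posFreq μ p k) (t k) := by
  have h : ∀ ω, (μ ω : EReal) * binLoss (p ω) t = ∑ k, (μ ω : EReal) *
      (if p ω k then negLog (t k) else negLog (1 - t k)) := fun ω =>
    EReal.coe_mul_sum_of_nonneg _ _ fun k => binTerm_nonneg (ht k) _
  rw [sum_congr rfl fun ω _ => h ω, sum_comm]
  refine sum_congr rfl fun k _ => ?_
  have hcompl : 1 - posFreq μ p k = ∑ ω, if p ω k then 0 else μ ω := by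
    rw [← hsum, posFreq, ← sum_sub_distrib]
    exact sum_congr rfl fun ω _ => by split_ifs <;> simp
  rw [binCrossEntropy, hcompl, posFreq,
    ← EReal.sum_coe_mul_of_nonneg _ _ (fun ω => by split_ifs <;> simp [hμ]),
    ← EReal.sum_coe_mul_of_nonneg _ _ (fun ω => by split_ifs <;> simp [hμ]), ← sum_add_distrib]
  exact sum_congr rfl fun ω _ => by split_ifs <;> simp

lemma ROvA_eq {K J : ℕ} {Ω : Type*} [Fintype Ω] (μ : Ω → ℝ) (Y : Ω → Fin K)
    (M : Fin J → Ω → Fin K) (jhat : (Fin J → ℝ) → Ω → Fin J) {s : Fin K → ℝ} {u : Fin J → ℝ}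
    (hs : ∀ y, s y ∈ Set.Icc (0 : ℝ) 1) (hu : ∀ j, u j ∈ Set.Icc (0 : ℝ) 1) :
    ROvA μ Y M jhat s u = ∑ ω, (μ ω : EReal) * binLoss (fun y => y = Y ω) s +
      ∑ ω, (μ ω : EReal) * binLoss
        (fun j => (univ.filter (fun i => M i ω = Y ω)).Nonempty ∧ j = jhat u ω) u := by
  rw [ROvA, ← sum_add_distrib]
  refine sum_congr rfl fun ω _ => ?_
  rw [← EReal.left_distrib_of_nonneg (binLoss_nonneg _ hs) (binLoss_nonneg _ hu), binLoss_eq]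
  congr 2
  split_ifs with h
  · simp only [h, true_and, binLoss_eq]
  · simp only [h, false_and, binLoss, if_false]

/-- assuming `0 < η_y < 1` for every class, `R_OvA` attains its minimum on
`[0,1]^K × [0,1]^J`, and every minimizer `(s*, u*)` satisfies `s*_y = η_y` for every
class `y`; in particular, every class index maximizing `s*_y` also maximizes `η_y`.
The selector `ĵ(ω)` is any element of `S(ω)` attaining `max_{j ∈ S(ω)} u_j`. -/
theorem stmt6
    {K J : ℕ} (hK : 0 < K) (hJ : 0 < J)
    {Ω : Type*} [Fintype Ω] [Nonempty Ω]
    (μ : Ω → ℝ) (hμ : ∀ ω, 0 ≤ μ ω) (hsum : ∑ ω, μ ω = 1)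
    (Y : Ω → Fin K) (M : Fin J → Ω → Fin K)
    (η : Fin K → ℝ) (hη : ∀ y, η y = ∑ ω ∈ univ.filter (fun ω => Y ω = y), μ ω)
    (hη01 : ∀ y : Fin K, 0 < η y ∧ η y < 1)
    (jhat : (Fin J → ℝ) → Ω → Fin J)
    (hjhat : ∀ (u : Fin J → ℝ) (ω : Ω)
      (h : (univ.filter (fun j => M j ω = Y ω)).Nonempty),
      jhat u ω ∈ univ.filter (fun j => M j ω = Y ω) ∧
      u (jhat u ω) = (univ.filter (fun j => M j ω = Y ω)).sup' h u) :
    (∃ p ∈ ovaBox K J, ∀ p' ∈ ovaBox K J,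
      ROvA μ Y M jhat p.1 p.2 ≤ ROvA μ Y M jhat p'.1 p'.2) ∧
    (∀ p ∈ ovaBox K J, (∀ p' ∈ ovaBox K J,
        ROvA μ Y M jhat p.1 p.2 ≤ ROvA μ Y M jhat p'.1 p'.2) →
      (∀ y : Fin K, p.1 y = η y) ∧
      (∀ y : Fin K, (∀ y' : Fin K, p.1 y' ≤ p.1 y) →
        ∀ y' : Fin K, η y' ≤ η y)) := by
  let p : (Ω → Fin J) → Ω → Fin J → Prop := fun σ ω j =>
    (univ.filter (fun i => M i ω = Y ω)).Nonempty ∧ j = σ ω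
  let a : (Ω → Fin J) → Fin J → ℝ := fun σ => posFreq μ (p σ)
  let sel : Set (Ω → Fin J) := {σ | ∀ ω, (univ.filter (fun i => M i ω = Y ω)).Nonempty →
    σ ω ∈ univ.filter (fun i => M i ω = Y ω)}
  have hsel : ∀ u, jhat u ∈ sel := fun u ω h => (hjhat u ω h).1
  have ha : ∀ σ j, a σ j ∈ Set.Icc (0 : ℝ) 1 := fun σ j => posFreq_mem_Icc hμ hsum _ j
  have hηeq : η = posFreq μ (fun ω y => y = Y ω) := by
    funext y
    rw [hη, posFreq, sum_filter]
    simp only [eq_comm]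
  have hηmem : ∀ y, η y ∈ Set.Icc (0 : ℝ) 1 := fun y => ⟨(hη01 y).1.le, (hη01 y).2.le⟩
  have hR : ∀ s u, (∀ y, s y ∈ Set.Icc (0 : ℝ) 1) → (∀ j, u j ∈ Set.Icc (0 : ℝ) 1) →
      ROvA μ Y M jhat s u = ∑ y, binCrossEntropy (η y) (s y) +
        ∑ j, binCrossEntropy (a (jhat u) j) (u j) := by
    intro s u hs hu
    rw [ROvA_eq μ Y M jhat hs hu, sum_mul_binLoss hμ hsum _ hs, hηeq]
    congr 1
    exact sum_mul_binLoss hμ hsum (p (jhat u)) hu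
  have hjmin : ∀ σ ∈ sel, ∀ u : Fin J → ℝ, (∀ j, u j ∈ Set.Icc (0 : ℝ) 1) →
      ∑ j, binCrossEntropy (a (jhat u) j) (u j) ≤ ∑ j, binCrossEntropy (a σ j) (u j) := by
    intro σ hσ u hu
    rw [← sum_mul_binLoss hμ hsum (p (jhat u)) hu, ← sum_mul_binLoss hμ hsum (p σ) hu]
    refine sum_le_sum fun ω _ => mul_le_mul_of_nonneg_left ?_ (by exact_mod_cast hμ ω)
    by_cases h : (univ.filter (fun i => M i ω = Y ω)).Nonempty
    · simp only [p, h, true_and]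
      refine binLoss_eq_le hu ?_
      rw [(hjhat u ω h).2]
      exact le_sup' u (hσ ω h)
    · simp only [p, h, false_and, le_refl]
  obtain ⟨σ, hσ, hσmin⟩ := Set.exists_min_image sel
    (fun σ => ∑ j, binCrossEntropy (a σ j) (a σ j)) (Set.toFinite sel) ⟨jhat 0, hsel 0⟩
  have hexp : ∀ u : Fin J → ℝ, (∀ j, u j ∈ Set.Icc (0 : ℝ) 1) →
      ∑ j, binCrossEntropy (a σ j) (a σ j) ≤ ∑ j, binCrossEntropy (a (jhat u) j) (u j) :=
    fun u hu => (hσmin _ (hsel u)).trans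
      (sum_le_sum fun j _ => binCrossEntropy_self_le (ha _ j) (hu j))
  have hopt : ROvA μ Y M jhat η (a σ) ≤ ∑ y, binCrossEntropy (η y) (η y) +
      ∑ j, binCrossEntropy (a σ j) (a σ j) := by
    rw [hR _ _ hηmem (ha σ)]
    exact add_le_add le_rfl (hjmin σ hσ _ (ha σ))
  refine ⟨⟨(η, a σ), ⟨hηmem, ha σ⟩, fun q hq => hopt.trans ?_⟩, fun q hq hmin => ?_⟩
  · rw [hR _ _ hq.1 hq.2]
    exact add_le_add (sum_le_sum fun y _ => binCrossEntropy_self_le (hηmem y) (hq.1 y))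
      (hexp _ hq.2)
  · have hq_le := (hmin (η, a σ) ⟨hηmem, ha σ⟩).trans hopt
    rw [hR _ _ hq.1 hq.2] at hq_le
    replace hq_le := (add_le_add le_rfl (hexp _ hq.2)).trans hq_le
    rw [sum_binCrossEntropy_self univ (a σ)] at hq_le
    have heq : ∀ y, q.1 y = η y := eq_of_sum_binCrossEntropy_le hηmem hq.1
      (le_of_not_gt fun hlt => hq_le.not_gt (EReal.add_lt_add_right_coe hlt _))
    refine ⟨heq, fun y hy y' => ?_⟩
    rw [← heq, ← heq]
    exact hy y'
end
end

section
/- Assume 0 < η_y < 1 for every y ∈ Fin K and that Condition 1 (Information Advantage of the Optimal Expert) holds with optimal expert j*. Then R_OvA attains its minimum on [0,1]^K × [0,1]^J, and every minimizer (s*, u*) satisfies: (i) s*_y = η_y for every y ∈ Fin K; (ii) u*_{j*} > u*_j for every j ≠ j*, i.e., j* is the unique argmax of the expert scores; (iii) u*_{j*} = Acc_{j*}; (iv) if Acc_{j*} > max_{y ∈ Fin K} η_y then u*_{j*} > s*_y for every y ∈ Fin K, so the overall maximum of the concatenated vector (s*, u*) is uniquely attained at the j*-th expert coordinate (the system defers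 to the optimal expert); and if Acc_{j*} < max_{y ∈ Fin K} η_y then every entry of maximal value in (s*, u*) is a class coordinate y with η_y = max_{y'} η_{y'} (the system predicts a Bayes-optimal class). Hence the argmax prediction link applied to any minimizer reproduces the Bayes-optimal learning-to-defer decision. -/
open Finset

noncomputable section

/-- `-log x` valued in `ℝ≥0∞`, with `-log 0 = ∞`. -/
def ennNegLog (x : ℝ) : ENNReal := if x = 0 then ⊤ else ENNReal.ofReal (-Real.log x)

lemma negLog_eq_coe {x : ℝ} (hx : x ∈ Set.Icc (0 : ℝ) 1) :
    negLog x = ((ennNegLog x : ENNReal) : EReal) := by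
  unfold negLog ennNegLog
  split_ifs
  · simp
  · rw [EReal.coe_ennreal_ofReal, max_eq_left]
    have := Real.log_nonpos hx.1 hx.2
    linarith

lemma one_sub_mem_Icc {x : ℝ} (hx : x ∈ Set.Icc (0 : ℝ) 1) : 1 - x ∈ Set.Icc (0 : ℝ) 1 :=
  ⟨by linarith [hx.2], by linarith [hx.1]⟩

lemma ennNegLog_anti {x y : ℝ} (hx : 0 ≤ x) (hxy : x ≤ y) : ennNegLog y ≤ ennNegLog x := by
  unfold ennNegLog
  rcases hx.eq_or_lt with h | h
  · simp [← h]
  · rw [if_neg h.ne', if_neg (h.trans_le hxy).ne']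
    exact ENNReal.ofReal_le_ofReal (neg_le_neg (Real.log_le_log h hxy))

/-- The cross-entropy of a Bernoulli variable of mean `w` against a score `v`. -/
def crossEntropy (w v : ℝ) : ENNReal :=
  ENNReal.ofReal w * ennNegLog v + ENNReal.ofReal (1 - w) * ennNegLog (1 - v)

lemma crossEntropy_of_mem_Ioo {w v : ℝ} (hw : w ∈ Set.Icc (0 : ℝ) 1)
    (hv : v ∈ Set.Ioo (0 : ℝ) 1) :
    crossEntropy w v = ENNReal.ofReal (w * -Real.log v + (1 - w) * -Real.log (1 - v)) := by
  have h1 : 0 ≤ -Real.log v := by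
    have := Real.log_nonpos hv.1.le hv.2.le
    linarith
  have h2 : 0 ≤ -Real.log (1 - v) := by
    have := Real.log_nonpos (x := 1 - v) (by linarith [hv.2]) (by linarith [hv.1])
    linarith
  have h3 : 0 ≤ 1 - w := by linarith [hw.2]
  have h4 : (1 - v) ≠ 0 := by linarith [hv.2]
  rw [crossEntropy, ennNegLog, ennNegLog, if_neg hv.1.ne', if_neg h4,
    ENNReal.ofReal_add (mul_nonneg hw.1 h1) (mul_nonneg h3 h2),
    ENNReal.ofReal_mul hw.1, ENNReal.ofReal_mul h3]

lemma crossEntropy_self {w : ℝ} (hw : w ∈ Set.Icc (0 : ℝ) 1) :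
    crossEntropy w w = ENNReal.ofReal (Real.binEntropy w) := by
  rcases hw.1.eq_or_lt with h | h
  · simp [crossEntropy, ennNegLog, ← h]
  rcases hw.2.eq_or_lt with h' | h'
  · simp [crossEntropy, ennNegLog, h']
  rw [crossEntropy_of_mem_Ioo hw ⟨h, h'⟩, Real.binEntropy, Real.log_inv, Real.log_inv]

lemma mul_log_sub_log_lt {p q : ℝ} (hp : 0 < p) (hq : 0 < q) (h : q ≠ p) :
    p * (Real.log q - Real.log p) < q - p := by
  have h1 : q / p ≠ 1 := fun e => h ((div_eq_one_iff_eq hp.ne').1 e)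
  have := Real.log_lt_sub_one_of_pos (div_pos hq hp) h1
  rw [Real.log_div hq.ne' hp.ne'] at this
  have h2 := mul_lt_mul_of_pos_left this hp
  have h3 : p * (q / p - 1) = q - p := by field_simp
  linarith

lemma binEntropy_lt_crossEntropy {w v : ℝ} (hw : w ∈ Set.Icc (0 : ℝ) 1)
    (hv : v ∈ Set.Icc (0 : ℝ) 1) (hne : v ≠ w) :
    ENNReal.ofReal (Real.binEntropy w) < crossEntropy w v := by
  rcases hv.1.eq_or_lt with h | h0
  · have hw0 : 0 < w := lt_of_le_of_ne hw.1 (by rwa [h])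
    have : crossEntropy w v = ⊤ := by
      simp [crossEntropy, ennNegLog, ← h, ENNReal.mul_top, hw0]
    rw [this]
    exact ENNReal.ofReal_lt_top
  rcases hv.2.eq_or_lt with h | h1
  · have hw1 : w < 1 := lt_of_le_of_ne hw.2 (by rw [← h]; exact hne.symm)
    have : crossEntropy w v = ⊤ := by
      simp [crossEntropy, ennNegLog, h, ENNReal.mul_top, hw1]
    rw [this]
    exact ENNReal.ofReal_lt_top
  rw [crossEntropy_of_mem_Ioo hw ⟨h0, h1⟩]
  have hlt : Real.binEntropy w < w * -Real.log v + (1 - w) * -Real.log (1 - v) := by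
    rw [Real.binEntropy, Real.log_inv, Real.log_inv]
    have e1 : Real.log v < 0 := Real.log_neg h0 h1
    have e2 : Real.log (1 - v) < 0 := Real.log_neg (by linarith) (by linarith)
    rcases hw.1.eq_or_lt with h | hw0
    · simp [← h, e2]
    rcases hw.2.eq_or_lt with h | hw1
    · simp [h, e1]
    have a := mul_log_sub_log_lt hw0 h0 hne
    have b := mul_log_sub_log_lt (p := 1 - w) (q := 1 - v) (by linarith) (by linarith)
      (fun e => hne (by linarith))
    nlinarith
  exact (ENNReal.ofReal_lt_ofReal_iff_of_nonneg (Real.binEntropy_nonneg hw.1 hw.2)).2 hlt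

lemma binEntropy_le_crossEntropy {w v : ℝ} (hw : w ∈ Set.Icc (0 : ℝ) 1)
    (hv : v ∈ Set.Icc (0 : ℝ) 1) :
    ENNReal.ofReal (Real.binEntropy w) ≤ crossEntropy w v := by
  by_cases h : v = w
  · rw [h, crossEntropy_self hw]
  · exact (binEntropy_lt_crossEntropy hw hv h).le

lemma eq_of_sum_crossEntropy_le {ι : Type*} [Fintype ι] {p v : ι → ℝ}
    (hp : ∀ i, p i ∈ Set.Icc (0 : ℝ) 1) (hv : ∀ i, v i ∈ Set.Icc (0 : ℝ) 1)
    (h : ∑ i, crossEntropy (p i) (v i) ≤ ∑ i, ENNReal.ofReal (Real.binEntropy (p i))) :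
    v = p := by
  classical
  funext i
  by_contra hne
  rw [← Finset.add_sum_erase _ _ (mem_univ i),
    ← Finset.add_sum_erase (a := i) univ (fun i => ENNReal.ofReal (Real.binEntropy (p i)))
      (mem_univ i)] at h
  refine absurd h (not_le.2 ?_)
  refine ENNReal.add_lt_add_of_lt_of_le ?_ (binEntropy_lt_crossEntropy (hp i) (hv i) hne)
    (Finset.sum_le_sum fun k _ => binEntropy_le_crossEntropy (hp k) (hv k))
  exact (ENNReal.sum_lt_top.2 fun _ _ => ENNReal.ofReal_lt_top).ne

lemma binEntropy_add_lt {a b a' b' : ℝ} (hb' : 0 ≤ b') (hba : b ≤ a) (haa' : a < a')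
    (ha' : a' ≤ 1) (hsum : a + b = a' + b') :
    Real.binEntropy a' + Real.binEntropy b' < Real.binEntropy a + Real.binEntropy b := by
  have hd : 0 < a' - b' := by linarith
  have key := Real.strictConcave_binEntropy.2 (x := a') (y := b') ⟨by linarith, ha'⟩
    ⟨hb', by linarith⟩ (by linarith)
  have h1 := key (a := (a - b') / (a' - b')) (b := (a' - a) / (a' - b'))
    (div_pos (by linarith) hd) (div_pos (by linarith) hd) (by field_simp; ring)
  have h2 := key (a := (b - b') / (a' - b')) (b := (a' - b) / (a' - b'))
    (div_pos (by linarith) hd) (div_pos (by linarith) hd) (by field_simp; ring)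
  simp only [smul_eq_mul] at h1 h2
  have e1 : (a - b') / (a' - b') * a' + (a' - a) / (a' - b') * b' = a := by
    field_simp; ring
  have e2 : (b - b') / (a' - b') * a' + (a' - b) / (a' - b') * b' = b := by
    field_simp; ring
  rw [e1] at h1
  rw [e2] at h2
  have e3 : (a - b') / (a' - b') = (a' - b) / (a' - b') := by congr 1; linarith
  have e4 : (a' - a) / (a' - b') = (b - b') / (a' - b') := by congr 1; linarith
  have e5 : (a - b') / (a' - b') + (a' - a) / (a' - b') = 1 := by field_simp; ring
  rw [← e3, ← e4] at h2
  generalize (a - b') / (a' - b') = t at h1 h2 e5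
  generalize (a' - a) / (a' - b') = r at h1 h2 e5
  obtain rfl : r = 1 - t := by linarith
  linarith

lemma sum_mul_sum_ite_eq_sum_crossEntropy {ι Ω : Type*} [Fintype ι] [Fintype Ω]
    {μ : Ω → ℝ} (hμ : ∀ ω, 0 ≤ μ ω) (hsum : ∑ ω, μ ω = 1)
    (P : ι → Ω → Prop) [∀ i, DecidablePred (P i)] (v : ι → ℝ) :
    ∑ ω, ENNReal.ofReal (μ ω) *
        ∑ i, (if P i ω then ennNegLog (v i) else ennNegLog (1 - v i)) =
      ∑ i, crossEntropy (∑ ω with P i ω, μ ω) (v i) := by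
  simp_rw [Finset.mul_sum]
  rw [Finset.sum_comm]
  refine Finset.sum_congr rfl fun i _ => ?_
  have hc : 1 - ∑ ω with P i ω, μ ω = ∑ ω with ¬ P i ω, μ ω := by
    rw [← hsum, ← Finset.sum_filter_add_sum_filter_not univ (P i)]
    ring
  rw [crossEntropy, hc, ENNReal.ofReal_sum_of_nonneg fun ω _ => hμ ω,
    ENNReal.ofReal_sum_of_nonneg fun ω _ => hμ ω, Finset.sum_mul, Finset.sum_mul,
    ← Finset.sum_filter_add_sum_filter_not univ (P i)]
  congr 1 <;>
  · refine Finset.sum_congr rfl fun ω hω => ?_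
    simp only [mem_filter, mem_univ, true_and] at hω
    simp [hω]

lemma sum_filter_mem_Icc {Ω : Type*} [Fintype Ω] {μ : Ω → ℝ} (hμ : ∀ ω, 0 ≤ μ ω)
    (hsum : ∑ ω, μ ω = 1) (P : Ω → Prop) [DecidablePred P] :
    ∑ ω with P ω, μ ω ∈ Set.Icc (0 : ℝ) 1 :=
  ⟨Finset.sum_nonneg fun ω _ => hμ ω, hsum ▸ Finset.sum_le_sum_of_subset_of_nonneg
    (Finset.filter_subset _ _) fun ω _ _ => hμ ω⟩

section Selection

variable {K J : ℕ} {Ω : Type*}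

/-- The set of experts that are correct at `ω`. -/
def correctExperts (Y : Ω → Fin K) (M : Fin J → Ω → Fin K) (ω : Ω) : Finset (Fin J) :=
  univ.filter (fun j => M j ω = Y ω)

lemma mem_correctExperts {Y : Ω → Fin K} {M : Fin J → Ω → Fin K} {ω : Ω} {j : Fin J} :
    j ∈ correctExperts Y M ω ↔ M j ω = Y ω := by
  simp [correctExperts]

/-- `c` selects a correct expert wherever there is one. -/
def IsSelection (Y : Ω → Fin K) (M : Fin J → Ω → Fin K) (c : Ω → Fin J) : Prop :=
  ∀ ω, (correctExperts Y M ω).Nonempty → c ω ∈ correctExperts Y M ω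

/-- `c` selects a correct expert with maximal score wherever there is a correct expert. -/
def IsMaxSelection (Y : Ω → Fin K) (M : Fin J → Ω → Fin K) (u : Fin J → ℝ)
    (c : Ω → Fin J) : Prop :=
  IsSelection Y M c ∧ ∀ ω, ∀ j ∈ correctExperts Y M ω, u j ≤ u (c ω)

/-- The mass of the points at which the correct expert selected by `c` is `j`. -/
def selectionMass [Fintype Ω] (μ : Ω → ℝ) (Y : Ω → Fin K) (M : Fin J → Ω → Fin K) (c : Ω → Fin J)
    (j : Fin J) : ℝ :=
  ∑ ω with ((correctExperts Y M ω).Nonempty ∧ c ω = j), μ ω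

lemma sum_ite_selection (c : Fin J) (u : Fin J → ℝ) (P : Prop) [Decidable P] :
    ∑ j, (if P ∧ c = j then ennNegLog (u j) else ennNegLog (1 - u j)) =
      if P then ennNegLog (u c) + ∑ j ∈ univ.erase c, ennNegLog (1 - u j)
      else ∑ j, ennNegLog (1 - u j) := by
  split_ifs with h
  · rw [← Finset.add_sum_erase _ _ (mem_univ c)]
    congr 1
    · simp [h]
    · refine Finset.sum_congr rfl fun j hj => ?_
      rw [if_neg fun e => Finset.ne_of_mem_erase hj e.2.symm]
  · simp [h]

lemma selection_cost_le {u : Fin J → ℝ} (hu : ∀ j, u j ∈ Set.Icc (0 : ℝ) 1) {a b : Fin J}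
    (hab : u b ≤ u a) :
    ennNegLog (u a) + ∑ j ∈ univ.erase a, ennNegLog (1 - u j) ≤
      ennNegLog (u b) + ∑ j ∈ univ.erase b, ennNegLog (1 - u j) := by
  by_cases h : a = b
  · rw [h]
  rw [← Finset.add_sum_erase (univ.erase a) _ (mem_erase.2 ⟨Ne.symm h, mem_univ b⟩),
    ← Finset.add_sum_erase (univ.erase b) _ (mem_erase.2 ⟨h, mem_univ a⟩),
    Finset.erase_right_comm]
  gcongr ?_ + (?_ + _)
  · exact ennNegLog_anti (hu b).1 hab
  · exact ennNegLog_anti (by linarith [(hu a).2]) (by linarith)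

lemma sum_crossEntropy_le_of_isMaxSelection [Fintype Ω] {μ : Ω → ℝ} (hμ : ∀ ω, 0 ≤ μ ω)
    (hsum : ∑ ω, μ ω = 1) {Y : Ω → Fin K} {M : Fin J → Ω → Fin K} {u : Fin J → ℝ}
    (hu : ∀ j, u j ∈ Set.Icc (0 : ℝ) 1) {c c' : Ω → Fin J}
    (hc : IsMaxSelection Y M u c) (hc' : IsSelection Y M c') :
    ∑ j, crossEntropy (selectionMass μ Y M c j) (u j) ≤
      ∑ j, crossEntropy (selectionMass μ Y M c' j) (u j) := by
  unfold selectionMass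
  rw [← sum_mul_sum_ite_eq_sum_crossEntropy hμ hsum
      (fun j ω => (correctExperts Y M ω).Nonempty ∧ c ω = j),
    ← sum_mul_sum_ite_eq_sum_crossEntropy hμ hsum
      (fun j ω => (correctExperts Y M ω).Nonempty ∧ c' ω = j)]
  refine Finset.sum_le_sum fun ω _ => ?_
  refine mul_le_mul' le_rfl ?_
  rw [sum_ite_selection, sum_ite_selection]
  split_ifs with h
  · exact selection_cost_le hu (hc.2 ω _ (hc' ω h))
  · exact le_rfl

lemma coe_ennreal_sum_eq {ι : Type*} (s : Finset ι) (f : ι → ENNReal) :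
    ((∑ i ∈ s, f i : ENNReal) : EReal) = ∑ i ∈ s, (f i : EReal) := by
  classical
  induction s using Finset.induction_on with
  | empty => simp
  | insert a s ha ih => rw [Finset.sum_insert ha, Finset.sum_insert ha, EReal.coe_ennreal_add, ih]

lemma rOvA_eq [Fintype Ω] {μ : Ω → ℝ} (hμ : ∀ ω, 0 ≤ μ ω)
    (hsum : ∑ ω, μ ω = 1) (Y : Ω → Fin K) (M : Fin J → Ω → Fin K)
    (jhat : (Fin J → ℝ) → Ω → Fin J) {s : Fin K → ℝ} {u : Fin J → ℝ}
    (hs : ∀ y, s y ∈ Set.Icc (0 : ℝ) 1) (hu : ∀ j, u j ∈ Set.Icc (0 : ℝ) 1) :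
    ROvA μ Y M jhat s u =
      ((∑ y, crossEntropy (∑ ω with Y ω = y, μ ω) (s y) +
        ∑ j, crossEntropy (selectionMass μ Y M (jhat u) j) (u j) : ENNReal) : EReal) := by
  unfold selectionMass
  rw [← sum_mul_sum_ite_eq_sum_crossEntropy hμ hsum (fun y ω => Y ω = y),
    ← sum_mul_sum_ite_eq_sum_crossEntropy hμ hsum
      (fun j ω => (correctExperts Y M ω).Nonempty ∧ jhat u ω = j),
    ← Finset.sum_add_distrib, coe_ennreal_sum_eq]
  refine Finset.sum_congr rfl fun ω _ => ?_
  rw [← mul_add, EReal.coe_ennreal_mul, EReal.coe_ennreal_ofReal, max_eq_left (hμ ω),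
    sum_ite_selection]
  have hY : ∑ y, (if Y ω = y then ennNegLog (s y) else ennNegLog (1 - s y)) =
      ennNegLog (s (Y ω)) + ∑ y ∈ univ.erase (Y ω), ennNegLog (1 - s y) := by
    simpa using sum_ite_selection (Y ω) s True
  have e1 : ∀ j, negLog (1 - u j) = (ennNegLog (1 - u j) : EReal) := fun j =>
    negLog_eq_coe (one_sub_mem_Icc (hu j))
  have e2 : ∀ y, negLog (1 - s y) = (ennNegLog (1 - s y) : EReal) := fun y =>
    negLog_eq_coe (one_sub_mem_Icc (hs y))
  rw [hY]
  simp only [e1, e2, negLog_eq_coe (hs _), negLog_eq_coe (hu _), ← coe_ennreal_sum_eq,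
    ← EReal.coe_ennreal_add]
  change _ * ((_ : EReal) + if (correctExperts Y M ω).Nonempty then _ else _) = _
  split_ifs <;> simp only [EReal.coe_ennreal_add]

/-- Moving mass between two coordinates so that they become more unequal strictly lowers the total
binary entropy. -/
lemma sum_binEntropy_lt {p q : Fin J → ℝ} (hp : ∀ j, p j ∈ Set.Icc (0 : ℝ) 1)
    (hq : ∀ j, q j ∈ Set.Icc (0 : ℝ) 1) {i j : Fin J} (hij : j ≠ i)
    (hrest : ∀ k, k ≠ i → k ≠ j → q k = p k) (hle : p i ≤ p j) (hlt : p j < q i)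
    (hadd : p j + p i = q i + q j) :
    ∑ k, ENNReal.ofReal (Real.binEntropy (q k)) <
      ∑ k, ENNReal.ofReal (Real.binEntropy (p k)) := by
  have hnn : ∀ {r : Fin J → ℝ}, (∀ k, r k ∈ Set.Icc (0 : ℝ) 1) → ∀ k ∈ univ,
      0 ≤ Real.binEntropy (r k) := fun hr k _ => Real.binEntropy_nonneg (hr k).1 (hr k).2
  rw [← ENNReal.ofReal_sum_of_nonneg (hnn hp), ← ENNReal.ofReal_sum_of_nonneg (hnn hq),
    ENNReal.ofReal_lt_ofReal_iff_of_nonneg (Finset.sum_nonneg (hnn hq))]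
  have hi : i ∈ univ.erase j := mem_erase.2 ⟨hij.symm, mem_univ i⟩
  rw [← Finset.add_sum_erase _ _ (mem_univ j), ← Finset.add_sum_erase _ _ hi,
    ← Finset.add_sum_erase univ (fun k => Real.binEntropy (p k)) (mem_univ j),
    ← Finset.add_sum_erase (univ.erase j) (fun k => Real.binEntropy (p k)) hi]
  have hr : ∑ k ∈ (univ.erase j).erase i, Real.binEntropy (q k) =
      ∑ k ∈ (univ.erase j).erase i, Real.binEntropy (p k) :=
    Finset.sum_congr rfl fun k hk => by
      rw [hrest k (ne_of_mem_erase hk) (ne_of_mem_erase (mem_of_mem_erase hk))]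
  have := binEntropy_add_lt (hq j).1 hle hlt (hq i).2 hadd
  rw [hr]
  linarith

open Classical in
/-- The selection that uses `d` where some expert of `A` is correct, and otherwise prefers `i`,
then `j`, then the choice of `c₀`. -/
def prioritySelection (Y : Ω → Fin K) (M : Fin J → Ω → Fin K) (A : Finset (Fin J))
    (d c₀ : Ω → Fin J) (i j : Fin J) (ω : Ω) : Fin J :=
  if ∃ l ∈ A, M l ω = Y ω then d ω
  else if M i ω = Y ω then i else if M j ω = Y ω then j else c₀ ω

section Priority

variable {Y : Ω → Fin K} {M : Fin J → Ω → Fin K} {A : Finset (Fin J)} {d c₀ : Ω → Fin J}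
  {i j : Fin J}

lemma isSelection_prioritySelection (hc₀ : IsSelection Y M c₀)
    (hd : ∀ ω, (∃ l ∈ A, M l ω = Y ω) → M (d ω) ω = Y ω) :
    IsSelection Y M (prioritySelection Y M A d c₀ i j) := by
  intro ω h
  have := hc₀ ω h
  rw [mem_correctExperts] at this ⊢
  unfold prioritySelection
  split_ifs with h1 h2 h3
  exacts [hd ω h1, h2, h3, this]

lemma prioritySelection_eq_iff (hc₀ : IsSelection Y M c₀)
    (hd : ∀ ω, (∃ l ∈ A, M l ω = Y ω) → d ω ∈ A) (hi : i ∉ A) (hij : i ≠ j) (ω : Ω) :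
    ((correctExperts Y M ω).Nonempty ∧ prioritySelection Y M A d c₀ i j ω = i) ↔
      ¬ (∃ l ∈ A, M l ω = Y ω) ∧ M i ω = Y ω := by
  constructor
  · rintro ⟨hS, h⟩
    have := mem_correctExperts.1 (hc₀ ω hS)
    unfold prioritySelection at h
    split_ifs at h with g1 g2 g3
    · exact absurd (h ▸ hd ω g1) hi
    · exact ⟨g1, g2⟩
    · exact absurd h.symm hij
    · exact absurd (h ▸ this) g2
  · rintro ⟨g1, g2⟩
    refine ⟨⟨i, mem_correctExperts.2 g2⟩, ?_⟩
    rw [prioritySelection, if_neg g1, if_pos g2]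

lemma coverage_insert_eq [Fintype Ω] (μ : Ω → ℝ) (hc₀ : IsSelection Y M c₀)
    (hd : ∀ ω, (∃ l ∈ A, M l ω = Y ω) → d ω ∈ A) (hi : i ∉ A) (hij : i ≠ j) :
    ∑ ω ∈ univ.filter (fun ω => ∃ l ∈ insert i A, M l ω = Y ω), μ ω =
      ∑ ω ∈ univ.filter (fun ω => ∃ l ∈ A, M l ω = Y ω), μ ω +
        selectionMass μ Y M (prioritySelection Y M A d c₀ i j) i := by
  classical
  unfold selectionMass
  simp only [prioritySelection_eq_iff hc₀ hd hi hij]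
  rw [← Finset.sum_union]
  · congr 1
    ext ω
    simp only [mem_union, mem_filter, mem_univ, true_and, Finset.exists_mem_insert]
    by_cases h : ∃ l ∈ A, M l ω = Y ω <;> simp [h]
  · rw [Finset.disjoint_filter]
    exact fun ω _ h1 h2 => h2.1 h1

lemma selectionMass_prioritySelection_swap [Fintype Ω] (μ : Ω → ℝ) {k : Fin J} (hki : k ≠ i)
    (hkj : k ≠ j) :
    selectionMass μ Y M (prioritySelection Y M A d c₀ i j) k =
      selectionMass μ Y M (prioritySelection Y M A d c₀ j i) k := by
  unfold selectionMass
  congr 1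
  refine Finset.filter_congr fun ω _ => and_congr_right fun _ => ?_
  unfold prioritySelection
  split_ifs <;> simp [hki.symm, hkj.symm]

lemma selectionMass_prioritySelection_add [Fintype Ω] (μ : Ω → ℝ) (hij : i ≠ j) :
    selectionMass μ Y M (prioritySelection Y M A d c₀ j i) j +
        selectionMass μ Y M (prioritySelection Y M A d c₀ j i) i =
      selectionMass μ Y M (prioritySelection Y M A d c₀ i j) i +
        selectionMass μ Y M (prioritySelection Y M A d c₀ i j) j := by
  simp only [selectionMass, Finset.sum_filter]
  rw [← Finset.sum_add_distrib, ← Finset.sum_add_distrib]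
  refine Finset.sum_congr rfl fun ω _ => ?_
  by_cases hS : (correctExperts Y M ω).Nonempty
  · simp only [hS, true_and]
    unfold prioritySelection
    split_ifs <;> simp_all
  · simp [hS]

lemma isMaxSelection_prioritySelection {u : Fin J → ℝ} (hc₀ : IsMaxSelection Y M u c₀)
    (hdS : ∀ ω, (∃ l ∈ A, M l ω = Y ω) → M (d ω) ω = Y ω)
    (hdA : ∀ ω, (∃ l ∈ A, M l ω = Y ω) → d ω ∈ A)
    (hdmax : ∀ ω, ∀ k ∈ A, M k ω = Y ω → u k ≤ u (d ω))
    (hle : u i ≤ u j) (hA : ∀ k ∈ A, u j ≤ u k)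
    (hnotA : ∀ k, k ∉ A → k ≠ j → u k ≤ u i) :
    IsMaxSelection Y M u (prioritySelection Y M A d c₀ j i) := by
  refine ⟨isSelection_prioritySelection hc₀.1 hdS, fun ω k hk => ?_⟩
  have hkS := mem_correctExperts.1 hk
  unfold prioritySelection
  split_ifs with h1 h2 h3
  · by_cases hkA : k ∈ A
    · exact hdmax ω k hkA hkS
    have hj := hA _ (hdA ω h1)
    by_cases e : k = j
    · rwa [e]
    · linarith [hnotA k hkA e]
  · by_cases e : k = j
    · rw [e]
    · linarith [hnotA k (fun hkA => h1 ⟨k, hkA, hkS⟩) e]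
  · exact hnotA k (fun hkA => h1 ⟨k, hkA, hkS⟩) fun e => h2 (e ▸ hkS)
  · exact hc₀.2 ω k hk

end Priority

lemma exists_selections_swap [Fintype Ω] {μ : Ω → ℝ} {Y : Ω → Fin K} {M : Fin J → Ω → Fin K}
    {u : Fin J → ℝ} {c₀ : Ω → Fin J} (hc₀ : IsMaxSelection Y M u c₀) {i j : Fin J}
    (hij : j ≠ i) (hle : u i ≤ u j)
    (hinfo : ∀ M' : Finset (Fin J), j ∉ M' → i ∉ M' →
      ∑ ω ∈ univ.filter (fun ω => ∃ k ∈ insert j M', M k ω = Y ω), μ ω <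
      ∑ ω ∈ univ.filter (fun ω => ∃ k ∈ insert i M', M k ω = Y ω), μ ω)
    (hmin : ∀ k, k ≠ i → u i ≤ u k → u j ≤ u k) :
    ∃ c c' : Ω → Fin J, IsMaxSelection Y M u c ∧ IsSelection Y M c' ∧
      (∀ k, k ≠ i → k ≠ j → selectionMass μ Y M c' k = selectionMass μ Y M c k) ∧
      selectionMass μ Y M c j < selectionMass μ Y M c' i ∧
      selectionMass μ Y M c j + selectionMass μ Y M c i =
        selectionMass μ Y M c' i + selectionMass μ Y M c' j := by
  classical
  obtain ⟨A, hA⟩ : ∃ A : Finset (Fin J), ∀ k, k ∈ A ↔ k ≠ i ∧ k ≠ j ∧ u i ≤ u k :=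
    ⟨univ.filter fun k => k ≠ i ∧ k ≠ j ∧ u i ≤ u k, by simp⟩
  have hiA : i ∉ A := fun h => ((hA i).1 h).1 rfl
  have hjA : j ∉ A := fun h => ((hA j).1 h).2.1 rfl
  have hd : ∀ ω, ∃ d, (∃ l ∈ A, M l ω = Y ω) →
      (d ∈ A ∧ M d ω = Y ω) ∧ ∀ k ∈ A, M k ω = Y ω → u k ≤ u d := by
    intro ω
    by_cases h : (A.filter fun l => M l ω = Y ω).Nonempty
    · obtain ⟨d, hd, hmax⟩ := Finset.exists_max_image _ u h
      exact ⟨d, fun _ => ⟨mem_filter.1 hd, fun k hk hkS => hmax k (mem_filter.2 ⟨hk, hkS⟩)⟩⟩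
    · exact ⟨i, fun ⟨l, hl, hlS⟩ => absurd ⟨l, mem_filter.2 ⟨hl, hlS⟩⟩ h⟩
  choose d hd using hd
  have hdA : ∀ ω, (∃ l ∈ A, M l ω = Y ω) → d ω ∈ A := fun ω h => (hd ω h).1.1
  have hdS : ∀ ω, (∃ l ∈ A, M l ω = Y ω) → M (d ω) ω = Y ω := fun ω h => (hd ω h).1.2
  refine ⟨prioritySelection Y M A d c₀ j i, prioritySelection Y M A d c₀ i j,
    isMaxSelection_prioritySelection hc₀ hdS hdA
      (fun ω k hk hkS => (hd ω ⟨k, hk, hkS⟩).2 k hk hkS) hle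
      (fun k hk => hmin k ((hA k).1 hk).1 ((hA k).1 hk).2.2) ?_,
    isSelection_prioritySelection hc₀.1 hdS,
    fun k h1 h2 => selectionMass_prioritySelection_swap μ h1 h2, ?_,
    selectionMass_prioritySelection_add μ hij.symm⟩
  · intro k hk hkj
    by_cases hki : k = i
    · rw [hki]
    · by_contra h
      exact hk ((hA k).2 ⟨hki, hkj, (not_le.1 h).le⟩)
  · have h1 := coverage_insert_eq μ hc₀.1 hdA hjA hij
    have h2 := coverage_insert_eq μ hc₀.1 hdA hiA hij.symm
    have := hinfo A hjA hiA
    linarith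

end Selection

/-- Consistency of PiCCE-OvA: under `0 < η_y < 1` for every class and
Condition 1 (Information Advantage of the Optimal Expert `j*`), `R_OvA` attains its
minimum on `[0,1]^K × [0,1]^J`, and every minimizer `(s*, u*)` satisfies:
(i) `s*_y = η_y`; (ii) `j*` is the unique argmax of `u*`; (iii) `u*_{j*} = Acc_{j*}`;
(iv) if `Acc_{j*} > max_y η_y` the overall maximum of `(s*, u*)` is uniquely attained at
the `j*`-th expert coordinate, and if `Acc_{j*} < max_y η_y` every maximal entry is a
class coordinate with maximal `η`. -/
theorem stmt12
    {K J : ℕ} (hK : 0 < K) (hJ : 0 < J)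
    {Ω : Type*} [Fintype Ω] [Nonempty Ω]
    (μ : Ω → ℝ) (hμ : ∀ ω, 0 ≤ μ ω) (hsum : ∑ ω, μ ω = 1)
    (Y : Ω → Fin K) (M : Fin J → Ω → Fin K)
    (η : Fin K → ℝ) (hη : ∀ y, η y = ∑ ω ∈ univ.filter (fun ω => Y ω = y), μ ω)
    (Acc : Fin J → ℝ)
    (hAcc : ∀ j, Acc j = ∑ ω ∈ univ.filter (fun ω => M j ω = Y ω), μ ω)
    (hη01 : ∀ y : Fin K, 0 < η y ∧ η y < 1)
    (jhat : (Fin J → ℝ) → Ω → Fin J)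
    (hjhat : ∀ (u : Fin J → ℝ) (ω : Ω)
      (h : (univ.filter (fun j => M j ω = Y ω)).Nonempty),
      jhat u ω ∈ univ.filter (fun j => M j ω = Y ω) ∧
      u (jhat u ω) = (univ.filter (fun j => M j ω = Y ω)).sup' h u)
    (jstar : Fin J)
    (hdom : ∀ j : Fin J, j ≠ jstar → Acc j < Acc jstar)
    (hinfo : ∀ j : Fin J, j ≠ jstar → ∀ M' : Finset (Fin J), j ∉ M' → jstar ∉ M' →
      ∑ ω ∈ univ.filter (fun ω => ∃ i ∈ insert j M', M i ω = Y ω), μ ω <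
      ∑ ω ∈ univ.filter (fun ω => ∃ i ∈ insert jstar M', M i ω = Y ω), μ ω) :
    (∃ p ∈ ovaBox K J, ∀ p' ∈ ovaBox K J,
      ROvA μ Y M jhat p.1 p.2 ≤ ROvA μ Y M jhat p'.1 p'.2) ∧
    (∀ p ∈ ovaBox K J, (∀ p' ∈ ovaBox K J,
        ROvA μ Y M jhat p.1 p.2 ≤ ROvA μ Y M jhat p'.1 p'.2) →
      (∀ y : Fin K, p.1 y = η y) ∧
      (∀ j : Fin J, j ≠ jstar → p.2 j < p.2 jstar) ∧
      (p.2 jstar = Acc jstar) ∧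
      ((∀ y : Fin K, η y < Acc jstar) →
        ∀ c : Fin K ⊕ Fin J, c ≠ Sum.inr jstar →
          Sum.elim p.1 p.2 c < p.2 jstar) ∧
      ((∃ y : Fin K, Acc jstar < η y) →
        ∀ c : Fin K ⊕ Fin J,
          (∀ c' : Fin K ⊕ Fin J, Sum.elim p.1 p.2 c' ≤ Sum.elim p.1 p.2 c) →
          ∃ y : Fin K, c = Sum.inl y ∧ ∀ y' : Fin K, η y' ≤ η y)) := by
  classical
  have hηI : ∀ y, η y ∈ Set.Icc (0 : ℝ) 1 := fun y => ⟨(hη01 y).1.le, (hη01 y).2.le⟩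
  have hwI : ∀ c j, selectionMass μ Y M c j ∈ Set.Icc (0 : ℝ) 1 := fun c j =>
    sum_filter_mem_Icc hμ hsum _
  have hmax : ∀ u, IsMaxSelection Y M u (jhat u) := by
    refine fun u => ⟨fun ω h => (hjhat u ω h).1, fun ω j hj => ?_⟩
    rw [(hjhat u ω ⟨j, hj⟩).2]
    exact Finset.le_sup' u hj
  have hR : ∀ s u, (s, u) ∈ ovaBox K J → ROvA μ Y M jhat s u =
      ((∑ y, crossEntropy (η y) (s y) +
        ∑ j, crossEntropy (selectionMass μ Y M (jhat u) j) (u j) : ENNReal) : EReal) := by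
    intro s u h
    simp only [hη]
    exact rOvA_eq hμ hsum Y M jhat h.1 h.2
  have hbox : ∀ c, (η, selectionMass μ Y M c) ∈ ovaBox K J := fun c => ⟨hηI, hwI c⟩
  have hRle : ∀ c, IsSelection Y M c → ROvA μ Y M jhat η (selectionMass μ Y M c) ≤
      ((∑ y, ENNReal.ofReal (Real.binEntropy (η y)) +
        ∑ j, ENNReal.ofReal (Real.binEntropy (selectionMass μ Y M c j)) : ENNReal) : EReal) := by
    intro c hc
    rw [hR _ _ (hbox c), EReal.coe_ennreal_le_coe_ennreal_iff]
    refine add_le_add (Finset.sum_le_sum fun y _ => (crossEntropy_self (hηI y)).le) ?_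
    refine (sum_crossEntropy_le_of_isMaxSelection hμ hsum (hwI c) (hmax _) hc).trans ?_
    exact Finset.sum_le_sum fun j _ => (crossEntropy_self (hwI c j)).le
  constructor
  · obtain ⟨c, hc, hcmin⟩ := Set.exists_min_image {c : Ω → Fin J | IsSelection Y M c}
      (fun c => ∑ j, ENNReal.ofReal (Real.binEntropy (selectionMass μ Y M c j)))
      (Set.toFinite _) ⟨jhat 0, (hmax 0).1⟩
    refine ⟨_, hbox c, fun p hp => (hRle c hc).trans ?_⟩
    rw [hR _ _ hp, EReal.coe_ennreal_le_coe_ennreal_iff]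
    refine add_le_add
      (Finset.sum_le_sum fun y _ => binEntropy_le_crossEntropy (hηI y) (hp.1 y)) ?_
    exact (hcmin _ (hmax p.2).1).trans
      (Finset.sum_le_sum fun j _ => binEntropy_le_crossEntropy (hwI _ j) (hp.2 j))
  · rintro ⟨s, u⟩ hp hopt
    dsimp only at hopt ⊢
    have hle : ∀ c c', IsMaxSelection Y M u c → IsSelection Y M c' →
        ∑ y, crossEntropy (η y) (s y) + ∑ j, crossEntropy (selectionMass μ Y M c j) (u j) ≤
        ∑ y, ENNReal.ofReal (Real.binEntropy (η y)) +
          ∑ j, ENNReal.ofReal (Real.binEntropy (selectionMass μ Y M c' j)) := by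
      intro c c' hc hc'
      have h := (hopt _ (hbox c')).trans (hRle c' hc')
      rw [hR _ _ hp, EReal.coe_ennreal_le_coe_ennreal_iff] at h
      exact (add_le_add le_rfl
        (sum_crossEntropy_le_of_isMaxSelection hμ hsum hp.2 hc (hmax u).1)).trans h
    have heq : ∀ c, IsMaxSelection Y M u c →
        Sum.elim s u = Sum.elim η (selectionMass μ Y M c) := by
      intro c hc
      refine eq_of_sum_crossEntropy_le ?_ ?_ ?_
      · rintro (y | j)
        exacts [hηI y, hwI c j]
      · rintro (y | j)
        exacts [hp.1 y, hp.2 j]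
      · simpa [Fintype.sum_sum_type] using hle c c hc hc.1
    have hs : ∀ y, s y = η y := fun y => congrFun (heq _ (hmax u)) (Sum.inl y)
    have hu : ∀ c, IsMaxSelection Y M u c → ∀ j, u j = selectionMass μ Y M c j :=
      fun c hc j => congrFun (heq c hc) (Sum.inr j)
    have hlt : ∀ j, j ≠ jstar → u j < u jstar := by
      by_contra! hcon
      obtain ⟨j₀, hj₀, hj₀'⟩ := hcon
      obtain ⟨j, hj, hjmin⟩ := Finset.exists_min_image
        (univ.filter fun j => j ≠ jstar ∧ u jstar ≤ u j) u ⟨j₀, by simp [hj₀, hj₀']⟩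
      simp only [mem_filter, mem_univ, true_and] at hj hjmin
      obtain ⟨c, c', hc, hc', hrest, hlt, hadd⟩ := exists_selections_swap (hmax u) hj.1 hj.2
        (hinfo j hj.1) fun k h1 h2 => hjmin k ⟨h1, h2⟩
      have hlt' := sum_binEntropy_lt (hwI c) (hwI c') hj.1 hrest
        (by rw [← hu c hc, ← hu c hc]; exact hj.2) hlt hadd
      have h1 := hle c c' hc hc'
      refine absurd h1 (not_le.2 (ENNReal.add_lt_add_of_le_of_lt ?_ ?_
        (hlt'.trans_le (Finset.sum_le_sum fun k _ =>
          binEntropy_le_crossEntropy (hwI c k) (hp.2 k)))))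
      · exact (ENNReal.sum_lt_top.2 fun _ _ => ENNReal.ofReal_lt_top).ne
      · exact Finset.sum_le_sum fun y _ => binEntropy_le_crossEntropy (hηI y) (hp.1 y)
    have hustar : u jstar = Acc jstar := by
      rw [hu _ (hmax u), hAcc, selectionMass]
      congr 1
      refine Finset.filter_congr fun ω _ => ⟨fun h => ?_, fun h => ?_⟩
      · have := (hmax u).1 ω h.1
        rwa [h.2, mem_correctExperts] at this
      · have hmem := mem_correctExperts.2 h
        refine ⟨⟨_, hmem⟩, ?_⟩
        by_contra hne
        exact absurd ((hmax u).2 ω _ hmem) (not_le.2 (hlt _ hne))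
    have hule : ∀ j, u j ≤ u jstar := fun j => by
      by_cases h : j = jstar
      · rw [h]
      · exact (hlt j h).le
    refine ⟨hs, hlt, hustar, ?_, ?_⟩
    · rintro h (y | j) hc
      · simpa [hs, hustar] using h y
      · exact hlt j fun e => hc (by rw [e])
    · rintro ⟨y₀, hy₀⟩ (y | j) hc
      · exact ⟨y, rfl, fun y' => by simpa [hs] using hc (Sum.inl y')⟩
      · have h1 := hc (Sum.inl y₀)
        simp only [Sum.elim_inl, Sum.elim_inr, hs] at h1
        linarith [hule j]
end
end

section
/- Suppose the expert predictions are conditionally independent given the label. Suppose there exists j* ∈ Fin J such that: (a) for every j ≠ j* and every y ∈ Fin K with η_y > 0, a_{j*,y} ≥ a_{j,y}; and (b) for every j ≠ j* there exists a class y_j ∈ Fin K with η_{y_j} > 0, a_{j*,y_j} > a_{j,y_j}, and a_{i,y_j} < 1 for every i ∈ Fin J \ {j, j*}. Then for every j ≠ j* and every subset M' ⊆ Fin J with j ∉ M' and j* ∉ M': μ({ω : ∃ i ∈ M' ∪ {j*}, M i ω = Y ω}) > μ({ω : ∃ i ∈ M' ∪ {j}, M i ω = Y ω}); that is, the Information Advantage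 inequality of Condition 1 holds for the dominant expert j*. -/
open Finset

/-- The probability that some expert of `S` predicts the label is one minus the total, over the
classes, of the mass on which every expert of `S` errs. -/
theorem sum_filter_eq_one_sub_sum_miss {ι κ Ω : Type*} [Fintype κ] [DecidableEq κ] [Fintype Ω]
    (μ : Ω → ℝ) (hsum : ∑ ω, μ ω = 1) (Y : Ω → κ) (M : ι → Ω → κ) (S : Finset ι) :
    ∑ ω ∈ univ.filter (fun ω => ∃ i ∈ S, M i ω = Y ω), μ ω =
      1 - ∑ y, ∑ ω ∈ univ.filter (fun ω => Y ω = y ∧ ∀ i ∈ S, M i ω ≠ y), μ ω := by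
  have hsplit := sum_filter_add_sum_filter_not univ (fun ω => ∃ i ∈ S, M i ω = Y ω) μ
  have hfib := sum_fiberwise (univ.filter (fun ω => ¬ ∃ i ∈ S, M i ω = Y ω)) Y μ
  have hmiss : ∀ y, (univ.filter (fun ω => ¬ ∃ i ∈ S, M i ω = Y ω)).filter (fun ω => Y ω = y) =
      univ.filter (fun ω => Y ω = y ∧ ∀ i ∈ S, M i ω ≠ y) := by
    intro y
    ext ω
    simp only [mem_filter, mem_univ, true_and, not_exists, not_and]
    constructor
    · rintro ⟨h, rfl⟩
      exact ⟨rfl, h⟩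
    · rintro ⟨rfl, h⟩
      exact ⟨h, rfl⟩
  simp only [hmiss] at hfib
  linarith

/-- Under conditional independence given `Y = y`, the mass on which no expert of `S` predicts `y`
is the product of the individual error probabilities. -/
theorem sum_miss_eq_mul_prod {ι κ Ω : Type*} [Fintype ι] [DecidableEq ι] [Fintype κ]
    [DecidableEq κ] [Fintype Ω] (μ : Ω → ℝ) (Y : Ω → κ) (M : ι → Ω → κ) (y : κ) (p : ℝ)
    (hp : p = ∑ ω ∈ univ.filter (fun ω => Y ω = y), μ ω) (hp0 : p ≠ 0)
    (hindep : ∀ m : ι → κ,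
      ∑ ω ∈ univ.filter (fun ω => Y ω = y ∧ ∀ j, M j ω = m j), μ ω =
        p * ∏ j, ((∑ ω ∈ univ.filter (fun ω => Y ω = y ∧ M j ω = m j), μ ω) / p))
    (S : Finset ι) :
    ∑ ω ∈ univ.filter (fun ω => Y ω = y ∧ ∀ i ∈ S, M i ω ≠ y), μ ω =
      p * ∏ i ∈ S, (1 - (∑ ω ∈ univ.filter (fun ω => Y ω = y ∧ M i ω = y), μ ω) / p) := by
  set q : ι → κ → ℝ :=
    fun j k => (∑ ω ∈ univ.filter (fun ω => Y ω = y ∧ M j ω = k), μ ω) / p with hq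
  have hq1 : ∀ j, ∑ k, q j k = 1 := by
    intro j
    have h := sum_fiberwise (univ.filter (fun ω => Y ω = y)) (M j) μ
    simp only [filter_filter] at h
    rw [hq, ← sum_div, h, ← hp, div_self hp0]
  let t : ι → Finset κ := fun i => if i ∈ S then univ.erase y else univ
  have hmaps : ∀ ω ∈ univ.filter (fun ω => Y ω = y ∧ ∀ i ∈ S, M i ω ≠ y),
      (fun i => M i ω) ∈ Fintype.piFinset t := by
    intro ω hω
    simp only [mem_filter, mem_univ, true_and] at hω
    rw [Fintype.mem_piFinset]
    intro i
    by_cases hi : i ∈ S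
    · simpa [t, hi] using hω.2 i hi
    · simp [t, hi]
  have hfiber : ∀ m ∈ Fintype.piFinset t,
      ∑ ω ∈ (univ.filter (fun ω => Y ω = y ∧ ∀ i ∈ S, M i ω ≠ y)).filter
        (fun ω => (fun i => M i ω) = m), μ ω = p * ∏ j, q j (m j) := by
    intro m hm
    rw [← hindep m]
    congr 1
    ext ω
    simp only [mem_filter, mem_univ, true_and, funext_iff]
    refine ⟨fun h => ⟨h.1.1, h.2⟩, fun h => ⟨⟨h.1, fun i hi => ?_⟩, h.2⟩⟩
    have hmi := Fintype.mem_piFinset.1 hm i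
    rw [h.2 i]
    simpa [t, hi] using hmi
  rw [← sum_fiberwise_of_maps_to hmaps, sum_congr rfl hfiber, ← mul_sum, ← prod_univ_sum]
  congr 1
  rw [← prod_subset (subset_univ S)]
  · refine prod_congr rfl fun i hi => ?_
    have h := sum_erase_add univ (q i) (mem_univ y)
    rw [hq1] at h
    simp only [t, hi, if_true]
    exact eq_sub_of_add_eq h
  · intro i _ hi
    simp only [t, hi, if_false, hq1]

/-- dominant expert ⟹ information advantage: if the expert predictions
are conditionally independent given the label, and `j*` dominates every other expert `j`
class-conditionally (with, for each `j ≠ j*`, a witness class `y_j` of positive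
probability where the domination is strict and all other experts are imperfect), then
the Information Advantage inequality of Condition 1 holds for `j*`. -/
theorem stmt14
    {K J : ℕ} (hK : 0 < K) (hJ : 0 < J)
    {Ω : Type*} [Fintype Ω] [Nonempty Ω]
    (μ : Ω → ℝ) (hμ : ∀ ω, 0 ≤ μ ω) (hsum : ∑ ω, μ ω = 1)
    (Y : Ω → Fin K) (M : Fin J → Ω → Fin K)
    (η : Fin K → ℝ) (hη : ∀ y, η y = ∑ ω ∈ univ.filter (fun ω => Y ω = y), μ ω)
    (a : Fin J → Fin K → ℝ)
    (ha : ∀ j y, a j y =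
      (∑ ω ∈ univ.filter (fun ω => Y ω = y ∧ M j ω = y), μ ω) / η y)
    (hindep : ∀ y : Fin K, 0 < η y → ∀ m : Fin J → Fin K,
      ∑ ω ∈ univ.filter (fun ω => Y ω = y ∧ ∀ j : Fin J, M j ω = m j), μ ω =
        η y * ∏ j : Fin J,
          ((∑ ω ∈ univ.filter (fun ω => Y ω = y ∧ M j ω = m j), μ ω) / η y))
    (jstar : Fin J)
    (hdomge : ∀ j : Fin J, j ≠ jstar → ∀ y : Fin K, 0 < η y → a j y ≤ a jstar y)
    (hstrict : ∀ j : Fin J, j ≠ jstar → ∃ y : Fin K, 0 < η y ∧ a j y < a jstar y ∧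
      ∀ i : Fin J, i ≠ j → i ≠ jstar → a i y < 1) :
    ∀ j : Fin J, j ≠ jstar → ∀ M' : Finset (Fin J), j ∉ M' → jstar ∉ M' →
      ∑ ω ∈ univ.filter (fun ω => ∃ i ∈ insert j M', M i ω = Y ω), μ ω <
      ∑ ω ∈ univ.filter (fun ω => ∃ i ∈ insert jstar M', M i ω = Y ω), μ ω := by
  intro j hj M' hjM' hsM'
  have hη0 : ∀ y, 0 ≤ η y := fun y => hη y ▸ sum_nonneg fun ω _ => hμ ω
  have hsub : ∀ (P : Ω → Prop) [DecidablePred P] (y : Fin K),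
      ∑ ω ∈ univ.filter (fun ω => Y ω = y ∧ P ω), μ ω ≤ η y := by
    intro P _ y
    rw [hη y, ← filter_filter]
    exact sum_le_sum_of_subset_of_nonneg (filter_subset _ _) fun ω _ _ => hμ ω
  have ha1 : ∀ i y, 0 ≤ 1 - a i y := by
    intro i y
    rw [ha, sub_nonneg]
    exact div_le_one_of_le₀ (hsub _ y) (hη0 y)
  have hmiss : ∀ y, 0 < η y → ∀ i, i ∉ M' →
      ∑ ω ∈ univ.filter (fun ω => Y ω = y ∧ ∀ k ∈ insert i M', M k ω ≠ y), μ ω =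
        η y * ((1 - a i y) * ∏ k ∈ M', (1 - a k y)) := by
    intro y hy i hi
    rw [← prod_insert (f := fun k => 1 - a k y) hi]
    simp only [ha]
    convert sum_miss_eq_mul_prod μ Y M y (η y) (hη y) hy.ne'
      (fun m => by convert hindep y hy m) (insert i M')
  have hmass : ∀ S : Finset (Fin J), ∑ ω ∈ univ.filter (fun ω => ∃ i ∈ S, M i ω = Y ω), μ ω =
      1 - ∑ y, ∑ ω ∈ univ.filter (fun ω => Y ω = y ∧ ∀ i ∈ S, M i ω ≠ y), μ ω := by
    intro S
    convert sum_filter_eq_one_sub_sum_miss μ hsum Y M S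
  rw [hmass, hmass]
  refine sub_lt_sub_left (sum_lt_sum (fun y _ => ?_) ?_) 1
  · rcases (hη0 y).eq_or_lt with hy | hy
    · exact ((hsub _ y).trans_eq hy.symm).trans (sum_nonneg fun ω _ => hμ ω)
    · rw [hmiss y hy _ hsM', hmiss y hy _ hjM']
      exact mul_le_mul_of_nonneg_left (mul_le_mul_of_nonneg_right
        (sub_le_sub_left (hdomge j hj y hy) 1) (prod_nonneg fun k _ => ha1 k y)) hy.le
  · obtain ⟨y, hy, hlt, himp⟩ := hstrict j hj
    refine ⟨y, mem_univ y, ?_⟩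
    rw [hmiss y hy _ hsM', hmiss y hy _ hjM']
    refine mul_lt_mul_of_pos_left (mul_lt_mul_of_pos_right (sub_lt_sub_left hlt 1)
      (prod_pos fun k hk => sub_pos.2 (himp k ?_ ?_))) hy
    · exact ne_of_mem_of_not_mem hk hjM'
    · exact ne_of_mem_of_not_mem hk hsM'
end

section
/- Suppose the expert predictions are conditionally independent given the label. Then for every subset M' ⊆ Fin J and all distinct j, j' ∈ Fin J \ M': μ(C_{M' ∪ {j'}}) − μ(C_{M' ∪ {j}}) = Σ_{y ∈ Fin K, η_y > 0} η_y·(a_{j',y} − a_{j,y})·∏_{i ∈ M'} (1 − a_{i,y}), where C_S = {ω : ∃ i ∈ S, M i ω = Y ω} denotes the event that at least one expert in the set S ⊆ Fin J is correct. -/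
open Finset

/-- Conditional independence extends from points to product sets. -/
theorem sum_filter_forall_mem_of_prod {K J : ℕ} {Ω : Type*} [Fintype Ω]
    (μ : Ω → ℝ) (Y : Ω → Fin K) (M : Fin J → Ω → Fin K) (y : Fin K) (c : ℝ)
    (p : Fin J → Fin K → ℝ)
    (h : ∀ m : Fin J → Fin K,
      ∑ ω ∈ univ.filter (fun ω => Y ω = y ∧ ∀ j : Fin J, M j ω = m j), μ ω =
        c * ∏ j : Fin J, p j (m j))
    (t : Fin J → Finset (Fin K)) :
    ∑ ω ∈ univ.filter (fun ω => Y ω = y ∧ ∀ j : Fin J, M j ω ∈ t j), μ ω =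
      c * ∏ j : Fin J, ∑ x ∈ t j, p j x := by
  rw [Finset.prod_univ_sum, Finset.mul_sum,
    ← Finset.sum_fiberwise_of_maps_to (t := Fintype.piFinset t)
      (g := fun ω j => M j ω) (fun ω hω => by simpa using (mem_filter.1 hω).2.2)]
  refine Finset.sum_congr rfl fun m hm => ?_
  rw [← h m, Finset.filter_filter]
  refine Finset.sum_congr (Finset.filter_congr fun ω _ => ?_) fun _ _ => rfl
  rw [Fintype.mem_piFinset] at hm
  constructor
  · rintro ⟨⟨h1, -⟩, h2⟩
    exact ⟨h1, fun j => congrFun h2 j⟩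
  · rintro ⟨h1, h2⟩
    exact ⟨⟨h1, fun j => h2 j ▸ hm j⟩, funext h2⟩

/-- Given a label of positive mass, the experts in `S` are all wrong with the product of the
individual error probabilities. -/
theorem sum_filter_forall_ne {K J : ℕ} {Ω : Type*} [Fintype Ω]
    (μ : Ω → ℝ) (Y : Ω → Fin K) (M : Fin J → Ω → Fin K) (y : Fin K) (c : ℝ) (hc : 0 < c)
    (hcy : c = ∑ ω ∈ univ.filter (fun ω => Y ω = y), μ ω)
    (h : ∀ m : Fin J → Fin K,
      ∑ ω ∈ univ.filter (fun ω => Y ω = y ∧ ∀ j : Fin J, M j ω = m j), μ ω =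
        c * ∏ j : Fin J,
          ((∑ ω ∈ univ.filter (fun ω => Y ω = y ∧ M j ω = m j), μ ω) / c))
    (S : Finset (Fin J)) :
    ∑ ω ∈ univ.filter (fun ω => Y ω = y ∧ ∀ i ∈ S, M i ω ≠ y), μ ω =
      c * ∏ i ∈ S,
        (1 - (∑ ω ∈ univ.filter (fun ω => Y ω = y ∧ M i ω = y), μ ω) / c) := by
  have key := sum_filter_forall_mem_of_prod μ Y M y c
    (fun j x => (∑ ω ∈ univ.filter (fun ω => Y ω = y ∧ M j ω = x), μ ω) / c) h
    (fun j => if j ∈ S then univ.erase y else univ)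
  have total : ∀ j : Fin J,
      ∑ x, (∑ ω ∈ univ.filter (fun ω => Y ω = y ∧ M j ω = x), μ ω) / c = 1 := by
    intro j
    rw [← Finset.sum_div, div_eq_one_iff_eq hc.ne', hcy,
      ← Finset.sum_fiberwise (univ.filter fun ω => Y ω = y) (M j)]
    simp only [Finset.filter_filter]
  have factor : ∀ j : Fin J,
      ∑ x ∈ (if j ∈ S then univ.erase y else univ),
        (∑ ω ∈ univ.filter (fun ω => Y ω = y ∧ M j ω = x), μ ω) / c =
      if j ∈ S then
        1 - (∑ ω ∈ univ.filter (fun ω => Y ω = y ∧ M j ω = y), μ ω) / c else 1 := by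
    intro j
    split_ifs
    · rw [← total j, ← Finset.sum_erase_add univ _ (mem_univ y), add_sub_cancel_right]
    · exact total j
  simp only [factor, Finset.prod_ite_mem, Finset.univ_inter] at key
  rw [← key]
  refine Finset.sum_congr (Finset.filter_congr fun ω _ => and_congr_right fun _ => ?_)
    fun _ _ => rfl
  refine forall_congr' fun i => ?_
  by_cases hi : i ∈ S <;> simp [hi]

/-- under conditional independence of the expert predictions given the
label, for every subset `M'` of experts and distinct `j, j' ∉ M'`,
`μ(C_{M' ∪ {j'}}) − μ(C_{M' ∪ {j}})
  = Σ_{y : η_y > 0} η_y (a_{j',y} − a_{j,y}) Π_{i ∈ M'} (1 − a_{i,y})`,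
where `C_S` is the event that at least one expert in `S` is correct. -/
theorem stmt15
    {K J : ℕ} (hK : 0 < K) (hJ : 0 < J)
    {Ω : Type*} [Fintype Ω] [Nonempty Ω]
    (μ : Ω → ℝ) (hμ : ∀ ω, 0 ≤ μ ω) (hsum : ∑ ω, μ ω = 1)
    (Y : Ω → Fin K) (M : Fin J → Ω → Fin K)
    (η : Fin K → ℝ) (hη : ∀ y, η y = ∑ ω ∈ univ.filter (fun ω => Y ω = y), μ ω)
    (a : Fin J → Fin K → ℝ)
    (ha : ∀ j y, a j y =
      (∑ ω ∈ univ.filter (fun ω => Y ω = y ∧ M j ω = y), μ ω) / η y)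
    (hindep : ∀ y : Fin K, 0 < η y → ∀ m : Fin J → Fin K,
      ∑ ω ∈ univ.filter (fun ω => Y ω = y ∧ ∀ j : Fin J, M j ω = m j), μ ω =
        η y * ∏ j : Fin J,
          ((∑ ω ∈ univ.filter (fun ω => Y ω = y ∧ M j ω = m j), μ ω) / η y)) :
    ∀ (M' : Finset (Fin J)) (j j' : Fin J), j ∉ M' → j' ∉ M' → j ≠ j' →
      (∑ ω ∈ univ.filter (fun ω => ∃ i ∈ insert j' M', M i ω = Y ω), μ ω)
        - (∑ ω ∈ univ.filter (fun ω => ∃ i ∈ insert j M', M i ω = Y ω), μ ω)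
      = ∑ y ∈ univ.filter (fun y : Fin K => 0 < η y),
          η y * (a j' y - a j y) * ∏ i ∈ M', (1 - a i y) := by
  have wrong : ∀ S : Finset (Fin J),
      ∑ ω ∈ univ.filter (fun ω => ¬ ∃ i ∈ S, M i ω = Y ω), μ ω =
        ∑ y ∈ univ.filter (fun y : Fin K => 0 < η y), η y * ∏ i ∈ S, (1 - a i y) := by
    intro S
    rw [← Finset.sum_fiberwise _ Y, Finset.sum_filter]
    refine Finset.sum_congr rfl fun y _ => ?_
    rw [Finset.filter_filter]
    have event : univ.filter (fun ω => (¬ ∃ i ∈ S, M i ω = Y ω) ∧ Y ω = y) =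
        univ.filter (fun ω => Y ω = y ∧ ∀ i ∈ S, M i ω ≠ y) := by
      refine Finset.filter_congr fun ω _ => ?_
      constructor
      · rintro ⟨h1, rfl⟩
        exact ⟨rfl, fun i hi h => h1 ⟨i, hi, h⟩⟩
      · rintro ⟨rfl, h1⟩
        exact ⟨fun ⟨i, hi, h⟩ => h1 i hi h, rfl⟩
    rw [event]
    split_ifs with hy
    · simp only [ha]
      exact sum_filter_forall_ne μ Y M y (η y) hy (hη y) (hindep y hy) S
    · refine le_antisymm ?_ (Finset.sum_nonneg fun ω _ => hμ ω)
      refine le_trans ?_ (not_lt.1 hy)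
      rw [hη]
      exact Finset.sum_le_sum_of_subset_of_nonneg
        (fun ω => by simp +contextual) fun ω _ _ => hμ ω
  have right : ∀ S : Finset (Fin J),
      ∑ ω ∈ univ.filter (fun ω => ∃ i ∈ S, M i ω = Y ω), μ ω =
        1 - ∑ y ∈ univ.filter (fun y : Fin K => 0 < η y), η y * ∏ i ∈ S, (1 - a i y) := by
    intro S
    rw [← wrong S, ← hsum, eq_sub_iff_add_eq]
    exact Finset.sum_filter_add_sum_filter_not _ _ _
  intro M' j j' hj hj' _
  rw [right, right, sub_sub_sub_cancel_left, ← Finset.sum_sub_distrib]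
  refine Finset.sum_congr rfl fun y _ => ?_
  rw [Finset.prod_insert hj, Finset.prod_insert hj']
  ring
end

section
/- Let K ≥ 2 and J = 2. Fix y ∈ Fin K and m : Fin 2 → Fin K with m 1 = y and m 2 ≠ y. Let φ_CE(θ, i) = −log(exp(θ_i)/Σ_{i' ∈ Fin (K+2)} exp(θ_{i'})) denote the cross-entropy (softmax log) loss on ℝ^{K+2}. Let ĵ : ℝ^{K+2} → {1, 2} be any function satisfying θ_{K+ĵ(θ)} = max(θ_{K+1}, θ_{K+2}) for every θ, and define the pick-the-confident-expert loss ℓ(θ) = φ_CE(θ, y) + (φ_CE(θ, K+ĵ(θ)) if m_{ĵ(θ)} = y, else 0). Then ℓ is discontinuous at every point θ₀ ∈ ℝ^{K+2} with θ₀_{K+1} = θ₀_{K+2}: approaching θ₀ through points where θ_{K+1} > θ_{K+2} the loss tends to φ_CE(θ₀, y) + φ_CE(θ₀, K+1), while approaching through points where θ_{K+2} > θ_{K+1} it tends to φ_CE(θ₀, y), and these two limits differ since φ_CE(θ₀, K+1) > 0; hence ℓ admits no continuous extension and is not a continuous function on ℝ^{K+2}, regardless of the tie-breaking rule ĵ.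 -/
open Filter

/-- A point whose coordinates `i` and `j` agree is a limit of points whose coordinate `i` is
strictly larger. -/
theorem neBot_nhdsWithin_lt_of_apply_eq {ι : Type*} [DecidableEq ι] {i j : ι} (hij : j ≠ i)
    {x : ι → ℝ} (hx : x j = x i) :
    (nhdsWithin x {z : ι → ℝ | z j < z i}).NeBot := by
  have hcont : Continuous fun t : ℝ => Function.update x i t :=
    continuous_const.update i continuous_id
  have htend : Tendsto (fun t : ℝ => Function.update x i t) (nhdsWithin (x i) (Set.Ioi (x i)))
      (nhdsWithin x {z : ι → ℝ | z j < z i}) := by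
    refine tendsto_nhdsWithin_iff.2 ⟨?_, ?_⟩
    · have h := hcont.tendsto (x i)
      rw [Function.update_eq_self] at h
      exact h.mono_left nhdsWithin_le_nhds
    · filter_upwards [self_mem_nhdsWithin] with t ht
      simpa [Function.update_of_ne hij, hx] using ht
  exact htend.neBot

/-- The softmax cross-entropy loss is continuous in the scores. -/
theorem continuous_neg_log_softmax {ι : Type*} [Fintype ι] (i : ι) :
    Continuous fun θ : ι → ℝ => -Real.log (Real.exp (θ i) / ∑ i', Real.exp (θ i')) := by
  have hsum (θ : ι → ℝ) : 0 < ∑ i', Real.exp (θ i') :=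
    Finset.sum_pos (fun _ _ => Real.exp_pos _) ⟨i, Finset.mem_univ i⟩
  refine (Continuous.log (Continuous.div (by fun_prop) (by fun_prop) fun θ => (hsum θ).ne')
    fun θ => (div_pos (Real.exp_pos _) (hsum θ)).ne').neg

/-- The softmax cross-entropy loss is strictly positive when there are at least two classes. -/
theorem neg_log_softmax_pos {ι : Type*} [Fintype ι] [Nontrivial ι] (θ : ι → ℝ) (i : ι) :
    0 < -Real.log (Real.exp (θ i) / ∑ i', Real.exp (θ i')) := by
  obtain ⟨j, hj⟩ := exists_ne i
  have hlt : Real.exp (θ i) < ∑ i', Real.exp (θ i') :=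
    Finset.single_lt_sum hj (Finset.mem_univ i) (Finset.mem_univ j) (Real.exp_pos _)
      fun _ _ _ => (Real.exp_pos _).le
  have hpos := (Real.exp_pos (θ i)).trans hlt
  exact neg_pos.2 (Real.log_neg (div_pos (Real.exp_pos _) hpos) ((div_lt_one hpos).2 hlt))

/-- discontinuity of the pick-the-confident-expert loss: with two experts,
expert 1 (index `0`) correct (`m 0 = y`) and expert 2 (index `1`) wrong (`m 1 ≠ y`),
the loss `ℓ(θ) = φ_CE(θ, y) + (φ_CE(θ, K+ĵ(θ)) if m_{ĵ(θ)} = y else 0)` is discontinuous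
at every tie point `θ₀_{K+1} = θ₀_{K+2}`: approaching through `θ_{K+1} > θ_{K+2}` it tends
to `φ_CE(θ₀, y) + φ_CE(θ₀, K+1)`, approaching through `θ_{K+2} > θ_{K+1}` it tends to
`φ_CE(θ₀, y)`, these differ since `φ_CE(θ₀, K+1) > 0`, and `ℓ` is not continuous at `θ₀`,
regardless of the tie-breaking rule `ĵ`. -/
theorem stmt16
    {K : ℕ} (hK : 2 ≤ K) (y : Fin K) (m : Fin 2 → Fin K)
    (hm0 : m 0 = y) (hm1 : m 1 ≠ y)
    (φ : (Fin (K + 2) → ℝ) → Fin (K + 2) → ℝ)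
    (hφ : ∀ (θ : Fin (K + 2) → ℝ) (i : Fin (K + 2)), φ θ i =
      -Real.log (Real.exp (θ i) / ∑ i' : Fin (K + 2), Real.exp (θ i')))
    (jhat : (Fin (K + 2) → ℝ) → Fin 2)
    (hjhat : ∀ θ : Fin (K + 2) → ℝ, θ (Fin.natAdd K (jhat θ)) =
      max (θ (Fin.natAdd K 0)) (θ (Fin.natAdd K 1)))
    (ℓ : (Fin (K + 2) → ℝ) → ℝ)
    (hℓ : ∀ θ : Fin (K + 2) → ℝ, ℓ θ = φ θ (Fin.castAdd 2 y) +
      if m (jhat θ) = y then φ θ (Fin.natAdd K (jhat θ)) else 0)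
    (θ₀ : Fin (K + 2) → ℝ) (h₀ : θ₀ (Fin.natAdd K 0) = θ₀ (Fin.natAdd K 1)) :
    Tendsto ℓ
      (nhdsWithin θ₀ {θ : Fin (K + 2) → ℝ | θ (Fin.natAdd K 1) < θ (Fin.natAdd K 0)})
      (nhds (φ θ₀ (Fin.castAdd 2 y) + φ θ₀ (Fin.natAdd K 0))) ∧
    Tendsto ℓ
      (nhdsWithin θ₀ {θ : Fin (K + 2) → ℝ | θ (Fin.natAdd K 0) < θ (Fin.natAdd K 1)})
      (nhds (φ θ₀ (Fin.castAdd 2 y))) ∧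
    0 < φ θ₀ (Fin.natAdd K 0) ∧
    ¬ ContinuousAt ℓ θ₀ := by
  have hcont (i : Fin (K + 2)) : Continuous fun θ => φ θ i := by
    simpa only [hφ] using continuous_neg_log_softmax i
  have hpos : 0 < φ θ₀ (Fin.natAdd K 0) := by
    rw [hφ]
    exact neg_log_softmax_pos θ₀ _
  have hne : Fin.natAdd K (0 : Fin 2) ≠ Fin.natAdd K (1 : Fin 2) := by
    simp [Fin.ext_iff]
  have hfst (θ : Fin (K + 2) → ℝ) (h : θ (Fin.natAdd K 1) < θ (Fin.natAdd K 0)) :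
      jhat θ = 0 := by
    have hmax := hjhat θ
    rw [max_eq_left h.le] at hmax
    by_contra hk
    rw [Fin.eq_one_of_ne_zero _ hk] at hmax
    exact h.ne hmax
  have hsnd (θ : Fin (K + 2) → ℝ) (h : θ (Fin.natAdd K 0) < θ (Fin.natAdd K 1)) :
      jhat θ = 1 := by
    have hmax := hjhat θ
    rw [max_eq_right h.le] at hmax
    refine Fin.eq_one_of_ne_zero _ fun hk => ?_
    rw [hk] at hmax
    exact h.ne hmax
  have hlim₁ : Tendsto ℓ
      (nhdsWithin θ₀ {θ : Fin (K + 2) → ℝ | θ (Fin.natAdd K 1) < θ (Fin.natAdd K 0)})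
      (nhds (φ θ₀ (Fin.castAdd 2 y) + φ θ₀ (Fin.natAdd K 0))) := by
    refine ((((hcont _).add (hcont _)).tendsto θ₀).mono_left nhdsWithin_le_nhds).congr' ?_
    filter_upwards [self_mem_nhdsWithin] with θ hθ
    rw [hℓ, hfst θ hθ, if_pos hm0, Pi.add_apply]
  have hlim₂ : Tendsto ℓ
      (nhdsWithin θ₀ {θ : Fin (K + 2) → ℝ | θ (Fin.natAdd K 0) < θ (Fin.natAdd K 1)})
      (nhds (φ θ₀ (Fin.castAdd 2 y))) := by
    refine (((hcont _).tendsto θ₀).mono_left nhdsWithin_le_nhds).congr' ?_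
    filter_upwards [self_mem_nhdsWithin] with θ hθ
    rw [hℓ, hsnd θ hθ, if_neg hm1, add_zero]
  refine ⟨hlim₁, hlim₂, hpos, fun hc => ?_⟩
  have := neBot_nhdsWithin_lt_of_apply_eq hne.symm h₀.symm
  have := neBot_nhdsWithin_lt_of_apply_eq hne h₀
  have h₁ := tendsto_nhds_unique hlim₁ (hc.tendsto.mono_left nhdsWithin_le_nhds)
  have h₂ := tendsto_nhds_unique hlim₂ (hc.tendsto.mono_left nhdsWithin_le_nhds)
  linarith
end
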